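/- arXiv:2103.09025 — 4 statements merged into one kernel-verified Lean document; each statement's English description precedes it below -/
import Mathlib

section
/- For each N ≥ 1, let X_N = U_N D_N U_N^* be an N×N Hermitian random matrix, where U_N is Haar-distributed on the unitary group U(N) and D_N is a random real diagonal matrix independent of U_N. Let λ_1^{(N)} ≤ ⋯ ≤ λ_N^{(N)} be the eigenvalues of X_N, let m_N = (1/N) Σ_{i=1}^N δ_{λ_i^{(N)}} be the empirical eigenvalue distribution, and let λ̃_1^{(N)} ≤ ⋯ ≤ λ̃_{N−1}^{(N)} be the eigenvalues of the principal submatrix X̃_N obtained by deleting the last row and column of X_N. Set M_k(κ_N) = Σ_{i=1}^N (λ_i^{(N)})^k − Σ_{j=1}^{N−1} (λ̃_j^{(N)})^k, and define random variables M_k(g_N) by the formal power series identity Σ_{n≥0} M_n(g_N) z^n = exp(Σ_{k≥1} (M_k(κ_N)/k) z^k), i.e., by the recursion M_k(κ_N) = k·M_k(g_N) − Σ_{r=1}^{k−1} M_r(κ_N)·M_{k−r}(g_N). Let m be a probability measure on ℝ with finite moments of all orders. Assume: (i) sup_{N≥1} E[M_k(m_N)] < ∞ for every even k; and (ii) for every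 k ≥ 1 and every ε > 0, P(|M_k(m_N) − M_k(m)| ≥ ε) → 0 as N → ∞. Then for every k ≥ 1 and every ε > 0, P(|M_k(g_N) − M_k(m)| ≥ ε) → 0 as N → ∞. -/
open MeasureTheory ProbabilityTheory Finset
open scoped Classical

/-- Measurable structure on matrices (entrywise, i.e. the product σ-algebra). -/
instance matrixMeasurableSpace {m n α : Type*} [MeasurableSpace α] :
    MeasurableSpace (Matrix m n α) :=
  inferInstanceAs (MeasurableSpace (m → n → α))

open PowerSeries in
/-- Logarithmic derivative of `∏ i, (1 - lᵢ X)`. -/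
lemma derivative_prod_one_sub_C_mul_X {ι : Type*} (s : Finset ι) (l : ι → ℂ) :
    d⁄dX ℂ (∏ i ∈ s, (1 - C (l i) * X))
      = -((∏ i ∈ s, (1 - C (l i) * X)) * PowerSeries.mk fun r => ∑ i ∈ s, l i ^ (r + 1)) := by
  induction s using Finset.induction_on with
  | empty =>
    have : (PowerSeries.mk fun _ : ℕ => (0 : ℂ)) = 0 := by
      ext; simp
    simp [this]
  | insert a s ha ih =>
    have hmk : (PowerSeries.mk fun r => ∑ i ∈ insert a s, l i ^ (r + 1))
        = (PowerSeries.mk fun r => l a ^ (r + 1))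
          + PowerSeries.mk fun r => ∑ i ∈ s, l i ^ (r + 1) := by
      ext r; simp [Finset.sum_insert ha]
    have hgeom : C (l a) = (1 - C (l a) * X) * PowerSeries.mk fun r => l a ^ (r + 1) := by
      ext r
      rw [sub_mul, one_mul, mul_assoc, map_sub, coeff_C_mul]
      cases r with
      | zero => simp
      | succ r => simp [coeff_succ_X_mul, pow_succ']
    have hder : d⁄dX ℂ (1 - C (l a) * X) = -C (l a) := by
      simp
    rw [Finset.prod_insert ha, Derivation.leibniz, ih, hder, hmk]
    simp only [smul_eq_mul]
    linear_combination -(∏ i ∈ s, (1 - C (l i) * X)) * hgeom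

open PowerSeries in
lemma one_sub_X_smul_mul_resolvent {n : ℕ} (A : Matrix (Fin n) (Fin n) ℂ) :
    (1 - (X : ℂ⟦X⟧) • A.map C) * Matrix.of (fun i j => PowerSeries.mk fun r => (A ^ r) i j)
      = 1 := by
  rw [sub_mul, one_mul]
  ext i j r
  have h : ((X : ℂ⟦X⟧) • A.map C * Matrix.of (fun i j => PowerSeries.mk fun r => (A ^ r) i j)) i j
      = X * ∑ k, C (A i k) * PowerSeries.mk fun r => (A ^ r) k j := by
    simp [Matrix.mul_apply, Finset.mul_sum, mul_assoc]
  rw [Matrix.sub_apply, h]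
  cases r with
  | zero => by_cases hij : i = j <;> simp [Matrix.one_apply, hij]
  | succ r =>
    have : coeff (r + 1) ((1 : Matrix (Fin n) (Fin n) ℂ⟦X⟧) i j) = 0 := by
      by_cases hij : i = j <;> simp [Matrix.one_apply, hij, coeff_one]
    rw [this, map_sub, coeff_succ_X_mul]
    simp [pow_succ', Matrix.mul_apply]

open PowerSeries in
lemma det_one_sub_X_smul_of_unitary_diagonal {n : ℕ} {A V : Matrix (Fin n) (Fin n) ℂ}
    (hV : V ∈ Matrix.unitaryGroup (Fin n) ℂ) {l : Fin n → ℂ}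
    (hA : A = V * Matrix.diagonal l * star V) :
    (1 - (X : ℂ⟦X⟧) • A.map C).det = ∏ i, (1 - C (l i) * X) := by
  have h1 : V.map (C (R := ℂ)) * (star V).map C = 1 := by
    rw [← Matrix.map_mul, Matrix.mem_unitaryGroup_iff.mp hV]
    simp
  have h2 : 1 - (X : ℂ⟦X⟧) • A.map C
      = V.map C * Matrix.diagonal (fun i => 1 - C (l i) * X) * (star V).map C := by
    have : Matrix.diagonal (fun i => 1 - C (l i) * X)
        = 1 - (X : ℂ⟦X⟧) • (Matrix.diagonal l).map C := by
      ext1 i j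
      by_cases hij : i = j <;> simp [hij, mul_comm]
    rw [this, hA, Matrix.map_mul, Matrix.map_mul, mul_sub, sub_mul, mul_one, h1]
    simp
  rw [h2, Matrix.det_mul, Matrix.det_mul, mul_right_comm, ← Matrix.det_mul, h1]
  simp

open PowerSeries in
/-- The Markov–Krein recursion between the differences of power traces of a matrix and of its
principal submatrix on the one hand, and the corner entries of its powers on the other. -/
lemma corner_pow_recursion {n : ℕ} {A V : Matrix (Fin (n + 1)) (Fin (n + 1)) ℂ}
    (hV : V ∈ Matrix.unitaryGroup (Fin (n + 1)) ℂ) {l : Fin (n + 1) → ℂ}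
    (hA : A = V * Matrix.diagonal l * star V)
    {W : Matrix (Fin n) (Fin n) ℂ} (hW : W ∈ Matrix.unitaryGroup (Fin n) ℂ) {l' : Fin n → ℂ}
    (hA' : A.submatrix Fin.castSucc Fin.castSucc = W * Matrix.diagonal l' * star W) (j : ℕ) :
    ((j : ℂ) + 1) * (A ^ (j + 1)) (Fin.last n) (Fin.last n)
      = ∑ r ∈ Finset.range (j + 1), ((∑ i, l i ^ (r + 1)) - ∑ i, l' i ^ (r + 1))
          * (A ^ (j - r)) (Fin.last n) (Fin.last n) := by
  set P : ℂ⟦X⟧ := ∏ i, (1 - C (l i) * X) with hP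
  set Q : ℂ⟦X⟧ := ∏ i, (1 - C (l' i) * X) with hQ
  set R : ℂ⟦X⟧ := PowerSeries.mk fun r => (A ^ r) (Fin.last n) (Fin.last n) with hR
  have hP0 : P ≠ 0 := by
    intro h
    have := congrArg (constantCoeff (R := ℂ)) h
    simp [hP, map_prod] at this
  have hQPR : Q = P * R := by
    have h := congrArg (fun M => (1 - (X : ℂ⟦X⟧) • A.map C).adjugate * M)
      (one_sub_X_smul_mul_resolvent A)
    simp only [← mul_assoc, Matrix.adjugate_mul, mul_one,
      det_one_sub_X_smul_of_unitary_diagonal hV hA] at h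
    have h' := congrFun (congrFun h (Fin.last n)) (Fin.last n)
    rw [Matrix.adjugate_fin_succ_eq_det_submatrix] at h'
    have hsub : (1 - (X : ℂ⟦X⟧) • A.map C).submatrix (Fin.last n).succAbove (Fin.last n).succAbove
        = 1 - (X : ℂ⟦X⟧) • (A.submatrix Fin.castSucc Fin.castSucc).map C := by
      ext1 i k
      by_cases hik : i = k <;> simp [Fin.succAbove_last, hik]
    rw [hsub, det_one_sub_X_smul_of_unitary_diagonal hW hA'] at h'
    simpa [hQ, hP, hR, Even.neg_one_pow (Even.add_self n)] using h'.symm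
  have hder := congrArg (d⁄dX ℂ) hQPR
  rw [Derivation.leibniz, hQ, derivative_prod_one_sub_C_mul_X, ← hQ, hP,
    derivative_prod_one_sub_C_mul_X, ← hP, hQPR] at hder
  simp only [smul_eq_mul] at hder
  have hmain : d⁄dX ℂ R
      = (PowerSeries.mk fun r => (∑ i, l i ^ (r + 1)) - ∑ i, l' i ^ (r + 1)) * R := by
    have hmk : (PowerSeries.mk fun r => (∑ i, l i ^ (r + 1)) - ∑ i, l' i ^ (r + 1))
        = (PowerSeries.mk fun r => ∑ i, l i ^ (r + 1))
          - PowerSeries.mk fun r => ∑ i, l' i ^ (r + 1) := by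
      ext r; simp
    rw [hmk]
    apply mul_left_cancel₀ hP0
    linear_combination -hder
  have hc := congrArg (coeff j) hmain
  rw [coeff_derivative, coeff_mul, Finset.Nat.sum_antidiagonal_eq_sum_range_succ_mk] at hc
  simp only [hR, coeff_mk] at hc
  rw [mul_comm, hc]

lemma pow_of_unitary_diagonal {n : ℕ} {A V : Matrix (Fin (n + 1)) (Fin (n + 1)) ℂ}
    (hV : V ∈ Matrix.unitaryGroup (Fin (n + 1)) ℂ) {d : Fin (n + 1) → ℝ}
    (hA : A = V * Matrix.diagonal (fun i => (d i : ℂ)) * star V) (k : ℕ) :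
    A ^ k = V * Matrix.diagonal (fun i => (d i : ℂ) ^ k) * star V := by
  have hV' := Matrix.mem_unitaryGroup_iff'.mp hV
  induction k with
  | zero => simp [Matrix.mem_unitaryGroup_iff.mp hV]
  | succ k ih =>
    have : Matrix.diagonal (fun i => (d i : ℂ) ^ (k + 1))
        = Matrix.diagonal (fun i => (d i : ℂ) ^ k) * Matrix.diagonal (fun i => (d i : ℂ)) := by
      simp [pow_succ]
    rw [pow_succ, ih, hA, this]
    calc _ = V * Matrix.diagonal (fun i => (d i : ℂ) ^ k) * (star V * V)
          * Matrix.diagonal (fun i => (d i : ℂ)) * star V := by simp only [mul_assoc]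
      _ = _ := by rw [hV']; simp only [mul_assoc, one_mul]

/-- The Markov–Krein recursion determines its solution. -/
lemma eq_of_markovKrein_recursion {κ c g : ℕ → ℝ} (hc0 : c 0 = 1)
    (hc : ∀ j : ℕ, ((j : ℝ) + 1) * c (j + 1) = ∑ r ∈ Finset.range (j + 1), κ (r + 1) * c (j - r))
    (hg : ∀ j : ℕ, 1 ≤ j → κ j = j * g j - ∑ r ∈ Finset.Ico 1 j, κ r * g (j - r))
    (j : ℕ) (hj : 1 ≤ j) : g j = c j := by
  induction j using Nat.strong_induction_on with
  | _ j ih =>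
    obtain ⟨i, rfl⟩ := Nat.exists_eq_add_of_le' hj
    have h1 := hg (i + 1) hj
    have h2 := hc i
    have h3 : ∑ r ∈ Finset.Ico 1 (i + 1), κ r * g (i + 1 - r)
        = ∑ r ∈ Finset.range i, κ (r + 1) * c (i - r) := by
      rw [Finset.sum_Ico_eq_sum_range]
      refine Finset.sum_congr (by simp) fun r hr => ?_
      rw [Finset.mem_range] at hr
      rw [ih (i + 1 - (1 + r)) (by omega) (by omega), add_comm 1 r, Nat.add_sub_add_right]
    rw [h3] at h1
    rw [Finset.sum_range_succ, Nat.sub_self, hc0] at h2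
    push_cast at h1
    have h4 : ((i : ℝ) + 1) * g (i + 1) = (i + 1) * c (i + 1) := by linarith
    exact mul_left_cancel₀ (by positivity) h4

lemma diagonal_conj_apply_self {n : ℕ} (V : Matrix (Fin n) (Fin n) ℂ) (d : Fin n → ℝ) (l : Fin n) :
    (V * Matrix.diagonal (fun i => (d i : ℂ)) * star V) l l
      = ((∑ i, d i * ‖V l i‖ ^ 2 : ℝ) : ℂ) := by
  rw [Matrix.mul_apply]
  push_cast
  refine Finset.sum_congr rfl fun i _ => ?_
  rw [Matrix.mul_diagonal, Matrix.star_apply, mul_right_comm, Complex.star_def, Complex.mul_conj']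
  ring

lemma trace_conj_diagonal {n : ℕ} {V : Matrix (Fin n) (Fin n) ℂ}
    (hV : V ∈ Matrix.unitaryGroup (Fin n) ℂ) (d : Fin n → ℝ) :
    (V * Matrix.diagonal (fun i => (d i : ℂ)) * star V).trace = ((∑ i, d i : ℝ) : ℂ) := by
  rw [Matrix.trace_mul_comm, ← mul_assoc, Matrix.mem_unitaryGroup_iff'.mp hV, one_mul,
    Matrix.trace_diagonal]
  simp

lemma sum_norm_sq_row_of_unitary {n : ℕ} {V : Matrix (Fin n) (Fin n) ℂ}
    (hV : V ∈ Matrix.unitaryGroup (Fin n) ℂ) (l : Fin n) : ∑ i, ‖V l i‖ ^ 2 = 1 := by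
  have h := diagonal_conj_apply_self V (fun _ => 1) l
  simp [Matrix.mem_unitaryGroup_iff.mp hV] at h
  exact_mod_cast h.symm

section Haar

variable {n : ℕ}

instance : MeasurableMul₂ (Matrix.unitaryGroup (Fin n) ℂ) where
  measurable_mul := by
    refine Measurable.subtype_mk ?_
    refine measurable_pi_lambda _ fun i => measurable_pi_lambda _ fun j => ?_
    have h : ∀ (k l : Fin n), Measurable fun g : Matrix.unitaryGroup (Fin n) ℂ => (g.1 k l) :=
      fun k l => (measurable_pi_apply l).comp ((measurable_pi_apply k).comp measurable_subtype_coe)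
    simp only [Matrix.mul_apply]
    exact Finset.measurable_fun_sum _ fun k _ =>
      ((h i k).comp measurable_fst).mul ((h k j).comp measurable_snd)

instance : MeasurableInv (Matrix.unitaryGroup (Fin n) ℂ) where
  measurable_inv := by
    refine Measurable.subtype_mk ?_
    refine measurable_pi_lambda _ fun i => measurable_pi_lambda _ fun j => ?_
    have h : Measurable fun g : Matrix.unitaryGroup (Fin n) ℂ => (g.1 j i) :=
      (measurable_pi_apply i).comp ((measurable_pi_apply j).comp measurable_subtype_coe)
    exact Complex.continuous_conj.measurable.comp h

lemma measurable_unitaryGroup_apply (i j : Fin n) :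
    Measurable fun g : Matrix.unitaryGroup (Fin n) ℂ => (g.1 i j) :=
  (measurable_pi_apply j).comp ((measurable_pi_apply i).comp measurable_subtype_coe)

/-- A left-invariant probability measure on a group is right-invariant. -/
lemma isMulRightInvariant_of_isMulLeftInvariant {G : Type*} [Group G] [MeasurableSpace G]
    [MeasurableMul₂ G] [MeasurableInv G] (μ : Measure G) [IsProbabilityMeasure μ]
    [μ.IsMulLeftInvariant] : μ.IsMulRightInvariant := by
  have : IsProbabilityMeasure μ.inv := Measure.isProbabilityMeasure_map measurable_inv.aemeasurable
  have h : μ = μ.inv := by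
    ext s hs
    have hf : Measurable (fun p : G × G => s.indicator (fun _ => (1 : ENNReal)) (p.1 * p.2)) :=
      (measurable_const.indicator hs).comp measurable_mul
    have h1 : ∫⁻ h, ∫⁻ g, s.indicator (fun _ => (1 : ENNReal)) (h * g) ∂μ ∂μ.inv = μ s := by
      simp_rw [lintegral_mul_left_eq_self (μ := μ) (s.indicator fun _ => (1 : ENNReal))]
      simp [lintegral_indicator, hs]
    have h2 : ∫⁻ g, ∫⁻ h, s.indicator (fun _ => (1 : ENNReal)) (h * g) ∂μ.inv ∂μ = μ.inv s := by
      simp_rw [lintegral_mul_right_eq_self (μ := μ.inv) (s.indicator fun _ => (1 : ENNReal))]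
      simp [lintegral_indicator, hs]
    rw [← h1, ← h2]
    exact lintegral_lintegral_swap hf.aemeasurable
  rw [h]
  infer_instance

/-- Every unit vector is a column of a unitary matrix. -/
lemma exists_unitary_column (v : EuclideanSpace ℂ (Fin n)) (hv : ‖v‖ = 1) (i : Fin n) :
    ∃ W : Matrix.unitaryGroup (Fin n) ℂ, ∀ k, W.1 k i = v k := by
  have hon : Orthonormal ℂ (({i} : Set (Fin n)).domRestrict fun _ => v) := by
    constructor
    · intro _; exact hv
    · intro a b hab; exact absurd (Subsingleton.elim a b) hab
  obtain ⟨b, hb⟩ := hon.exists_orthonormalBasis_extension_of_card_eq (by simp)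
  refine ⟨⟨_, (EuclideanSpace.basisFun (Fin n) ℂ).toMatrix_orthonormalBasis_mem_unitary b⟩,
    fun k => ?_⟩
  simp [Module.Basis.toMatrix_apply, hb i rfl]

lemma norm_entry_sq_le_one (g : Matrix.unitaryGroup (Fin n) ℂ) (l i : Fin n) :
    ‖g.1 l i‖ ^ 2 ≤ 1 := by
  rw [← sum_norm_sq_row_of_unitary g.2 l]
  exact Finset.single_le_sum (f := fun i => ‖g.1 l i‖ ^ 2) (fun _ _ => by positivity)
    (Finset.mem_univ i)

lemma integrable_of_measurable_of_bounded {G : Type*} [MeasurableSpace G] {μ : Measure G}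
    [IsFiniteMeasure μ] {f : G → ℝ} (hf : Measurable f) (C : ℝ) (hC : ∀ x, |f x| ≤ C) :
    Integrable f μ :=
  Integrable.of_bound hf.aestronglyMeasurable C (Filter.Eventually.of_forall hC)

lemma integrable_norm_entry_sq (μ : Measure (Matrix.unitaryGroup (Fin n) ℂ))
    [IsFiniteMeasure μ] (l i : Fin n) : Integrable (fun g => ‖g.1 l i‖ ^ 2) μ :=
  integrable_of_measurable_of_bounded ((measurable_unitaryGroup_apply l i).norm.pow_const 2) 1
    fun g => by rw [abs_of_nonneg (by positivity)]; exact norm_entry_sq_le_one g l i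

lemma integrable_norm_entry_sq_mul (μ : Measure (Matrix.unitaryGroup (Fin n) ℂ))
    [IsFiniteMeasure μ] (l i j : Fin n) :
    Integrable (fun g => ‖g.1 l i‖ ^ 2 * ‖g.1 l j‖ ^ 2) μ :=
  integrable_of_measurable_of_bounded
    (((measurable_unitaryGroup_apply l i).norm.pow_const 2).mul
      ((measurable_unitaryGroup_apply l j).norm.pow_const 2)) 1
    fun g => by
      rw [abs_of_nonneg (by positivity)]
      exact mul_le_one₀ (norm_entry_sq_le_one g l i) (by positivity) (norm_entry_sq_le_one g l j)

variable (μ : Measure (Matrix.unitaryGroup (Fin n) ℂ)) [μ.IsMulRightInvariant]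

/-- The law of `∑ k, g l k * v k` is the same for all unit vectors `v`. -/
lemma integral_norm_row_combination_pow (l i : Fin n) (p : ℕ) (v : EuclideanSpace ℂ (Fin n))
    (hv : ‖v‖ = 1) : ∫ g, ‖∑ k, g.1 l k * v k‖ ^ p ∂μ = ∫ g, ‖g.1 l i‖ ^ p ∂μ := by
  obtain ⟨W, hW⟩ := exists_unitary_column v hv i
  rw [← integral_mul_right_eq_self (μ := μ) (fun g => ‖g.1 l i‖ ^ p) W]
  simp [Matrix.mul_apply, hW]

lemma integral_norm_entry_pow_eq (l i j : Fin n) (p : ℕ) :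
    ∫ g, ‖g.1 l i‖ ^ p ∂μ = ∫ g, ‖g.1 l j‖ ^ p ∂μ := by
  rw [← integral_norm_row_combination_pow μ l j p (EuclideanSpace.single i 1) (by simp)]
  simp

lemma parallelogram_pow_four (a b : ℂ) :
    ‖a + b‖ ^ 4 + ‖a - b‖ ^ 4 + ‖a + Complex.I * b‖ ^ 4 + ‖a - Complex.I * b‖ ^ 4
      = 4 * (‖a‖ ^ 2 * ‖a‖ ^ 2) + 4 * (‖b‖ ^ 2 * ‖b‖ ^ 2) + 16 * (‖a‖ ^ 2 * ‖b‖ ^ 2) := by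
  have h : ∀ z : ℂ, ‖z‖ ^ 4 = (‖z‖ ^ 2) ^ 2 := fun z => by ring
  simp only [h, ← Complex.normSq_eq_norm_sq, Complex.normSq_apply]
  simp
  ring

lemma integral_norm_add_smul_pow_four (l i j : Fin n) (hij : i ≠ j) (c : ℂ) (hc : ‖c‖ = 1) :
    ∫ g, ‖g.1 l i + c * g.1 l j‖ ^ 4 ∂μ = 4 * ∫ g, ‖g.1 l i‖ ^ 2 * ‖g.1 l i‖ ^ 2 ∂μ := by
  set v : EuclideanSpace ℂ (Fin n) := ((√2)⁻¹ : ℂ) •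
    (EuclideanSpace.single i 1 + c • EuclideanSpace.single j 1) with hvdef
  have hnorm : ‖(EuclideanSpace.single i 1 + c • EuclideanSpace.single j 1 :
      EuclideanSpace ℂ (Fin n))‖ = √2 := by
    have h := norm_add_sq_eq_norm_sq_add_norm_sq_of_inner_eq_zero
      (EuclideanSpace.single i 1 : EuclideanSpace ℂ (Fin n)) (c • EuclideanSpace.single j 1)
      (by rw [inner_smul_right, EuclideanSpace.inner_single_left]; simp [hij])
    rw [norm_smul, hc] at h
    simp only [PiLp.norm_single, norm_one, mul_one] at h
    rw [eq_comm, Real.sqrt_eq_iff_mul_self_eq (by norm_num) (norm_nonneg _), h]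
    norm_num
  have hv : ‖v‖ = 1 := by
    rw [hvdef, norm_smul, hnorm]
    simp [abs_of_pos (Real.sqrt_pos.mpr (zero_lt_two' ℝ))]
  have hsum : ∀ g : Matrix.unitaryGroup (Fin n) ℂ,
      ‖∑ k, g.1 l k * v k‖ ^ 4 = (1 / 4) * ‖g.1 l i + c * g.1 l j‖ ^ 4 := by
    intro g
    have : ∑ k, g.1 l k * v k = ((√2)⁻¹ : ℂ) * (g.1 l i + c * g.1 l j) := by
      simp [hvdef, mul_add, Finset.sum_add_distrib]
      ring
    rw [this, norm_mul, mul_pow]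
    congr 1
    have h2 : √2 ^ 4 = (4 : ℝ) := by
      rw [show 4 = 2 * 2 from rfl, pow_mul, Real.sq_sqrt (by norm_num)]; norm_num
    rw [norm_inv, inv_pow, Complex.norm_real, Real.norm_of_nonneg (Real.sqrt_nonneg _), h2]
    norm_num
  have h := integral_norm_row_combination_pow μ l i 4 v hv
  simp_rw [hsum, integral_const_mul] at h
  have h4 : ∀ g : Matrix.unitaryGroup (Fin n) ℂ, ‖g.1 l i‖ ^ 2 * ‖g.1 l i‖ ^ 2 = ‖g.1 l i‖ ^ 4 :=
    fun g => by ring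
  simp_rw [h4]
  linarith

variable [IsProbabilityMeasure μ]

lemma integral_norm_entry_sq (l i : Fin n) : ∫ g, ‖g.1 l i‖ ^ 2 ∂μ = 1 / n := by
  have h : ∑ j, ∫ g, ‖g.1 l j‖ ^ 2 ∂μ = 1 := by
    rw [← integral_finsetSum _ fun j _ => integrable_norm_entry_sq μ l j]
    simp [sum_norm_sq_row_of_unitary (Subtype.prop _) l]
  simp_rw [fun j => integral_norm_entry_pow_eq μ l j i 2] at h
  have hn : (n : ℝ) ≠ 0 := by
    have := i.pos
    positivity
  rw [Finset.sum_const, Finset.card_univ, Fintype.card_fin, nsmul_eq_mul] at h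
  field_simp
  linarith

lemma integral_norm_entry_sq_mul (l i j : Fin n) (hij : i ≠ j) :
    ∫ g, ‖g.1 l i‖ ^ 2 * ‖g.1 l j‖ ^ 2 ∂μ = (1 / 2) * ∫ g, ‖g.1 l i‖ ^ 2 * ‖g.1 l i‖ ^ 2 ∂μ := by
  have hint : ∀ c : ℂ, ‖c‖ = 1 → Integrable (fun g => ‖g.1 l i + c * g.1 l j‖ ^ 4) μ := by
    intro c hc
    refine integrable_of_measurable_of_bounded (((measurable_unitaryGroup_apply l i).add
      ((measurable_unitaryGroup_apply l j).const_mul c)).norm.pow_const 4) (2 ^ 4) fun g => ?_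
    rw [abs_of_nonneg (by positivity)]
    have h1 : ∀ k, ‖g.1 l k‖ ≤ 1 := fun k =>
      (sq_le_one_iff₀ (norm_nonneg _)).mp (norm_entry_sq_le_one g l k)
    gcongr
    calc _ ≤ ‖g.1 l i‖ + ‖c‖ * ‖g.1 l j‖ := by rw [← norm_mul]; exact norm_add_le _ _
      _ ≤ 2 := by rw [hc]; linarith [h1 i, h1 j]
  have h1 := hint 1 (by simp)
  have h2 := hint (-1) (by simp)
  have h3 := hint Complex.I (by simp)
  have h4 := hint (-Complex.I) (by simp)
  have h := integral_congr_ae (μ := μ) (Filter.Eventually.of_forall fun g =>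
    parallelogram_pow_four (g.1 l i) (g.1 l j))
  have hii := (integrable_norm_entry_sq_mul μ l i i).const_mul 4
  have hjj := (integrable_norm_entry_sq_mul μ l j j).const_mul 4
  have hij' := (integrable_norm_entry_sq_mul μ l i j).const_mul 16
  rw [integral_add (hii.fun_add hjj) hij', integral_add hii hjj, integral_const_mul,
    integral_const_mul, integral_const_mul] at h
  have e1 := integral_norm_add_smul_pow_four μ l i j hij 1 (by simp)
  have e2 := integral_norm_add_smul_pow_four μ l i j hij (-1) (by simp)
  have e3 := integral_norm_add_smul_pow_four μ l i j hij Complex.I (by simp)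
  have e4 := integral_norm_add_smul_pow_four μ l i j hij (-Complex.I) (by simp)
  have ejj : ∫ g, ‖g.1 l j‖ ^ 2 * ‖g.1 l j‖ ^ 2 ∂μ = ∫ g, ‖g.1 l i‖ ^ 2 * ‖g.1 l i‖ ^ 2 ∂μ := by
    simpa only [← pow_add] using integral_norm_entry_pow_eq μ l j i 4
  simp only [one_mul, neg_mul, ← sub_eq_add_neg] at h1 h2 h3 h4 e1 e2 e3 e4
  rw [integral_add ((h1.fun_add h2).fun_add h3) h4,
    integral_add (h1.fun_add h2) h3, integral_add h1 h2,
    e1, e2, e3, e4, ejj] at h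
  linarith

lemma integral_norm_entry_sq_sq (l i : Fin n) :
    ∫ g, ‖g.1 l i‖ ^ 2 * ‖g.1 l i‖ ^ 2 ∂μ = 2 / (n * (n + 1)) := by
  have hn : (0 : ℝ) < n := by exact_mod_cast i.pos
  set A := ∫ g, ‖g.1 l i‖ ^ 2 * ‖g.1 l i‖ ^ 2 ∂μ with hA
  have hsum : ∑ j, ∫ g, ‖g.1 l i‖ ^ 2 * ‖g.1 l j‖ ^ 2 ∂μ = 1 / n := by
    rw [← integral_finsetSum _ fun j _ => integrable_norm_entry_sq_mul μ l i j,
      ← integral_norm_entry_sq μ l i]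
    refine integral_congr_ae (Filter.Eventually.of_forall fun g => ?_)
    simp only [← Finset.mul_sum]
    rw [sum_norm_sq_row_of_unitary g.2 l, mul_one]
  rw [← Finset.add_sum_erase _ _ (Finset.mem_univ i),
    Finset.sum_congr rfl fun j hj =>
      integral_norm_entry_sq_mul μ l i j (Finset.ne_of_mem_erase hj).symm,
    ← hA, Finset.sum_const, Finset.card_erase_of_mem (Finset.mem_univ i), Finset.card_univ,
    Fintype.card_fin, nsmul_eq_mul, Nat.cast_sub i.pos] at hsum
  field_simp at hsum ⊢
  push_cast at hsum
  linarith

/-- Covariances of the squared moduli of the entries of a row of a Haar unitary matrix. -/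
lemma integral_norm_entry_sq_centered_mul (l i j : Fin n) :
    ∫ g : Matrix.unitaryGroup (Fin n) ℂ,
        (‖g.1 l i‖ ^ 2 - 1 / (n : ℝ)) * (‖g.1 l j‖ ^ 2 - 1 / (n : ℝ)) ∂μ
      = (if i = j then 1 / ((n : ℝ) * (n + 1)) else 0) - 1 / ((n : ℝ) ^ 2 * (n + 1)) := by
  have hn : (0 : ℝ) < n := by exact_mod_cast i.pos
  have hexp : ∀ g : Matrix.unitaryGroup (Fin n) ℂ,
      (‖g.1 l i‖ ^ 2 - 1 / (n : ℝ)) * (‖g.1 l j‖ ^ 2 - 1 / (n : ℝ))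
        = ‖g.1 l i‖ ^ 2 * ‖g.1 l j‖ ^ 2 - (1 / (n : ℝ)) * ‖g.1 l i‖ ^ 2
          - ((1 / (n : ℝ)) * ‖g.1 l j‖ ^ 2 - 1 / (n : ℝ) * (1 / n)) := fun g => by ring
  have hi := (integrable_norm_entry_sq μ l i).const_mul (1 / (n : ℝ))
  have hj := (integrable_norm_entry_sq μ l j).const_mul (1 / (n : ℝ))
  have hij := integrable_norm_entry_sq_mul μ l i j
  have hc : Integrable (fun _ : Matrix.unitaryGroup (Fin n) ℂ => 1 / (n : ℝ) * (1 / n)) μ :=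
    integrable_const _
  simp_rw [hexp]
  have hiji : Integrable (fun g : Matrix.unitaryGroup (Fin n) ℂ =>
      ‖g.1 l i‖ ^ 2 * ‖g.1 l j‖ ^ 2 - (1 / (n : ℝ)) * ‖g.1 l i‖ ^ 2) μ := hij.sub hi
  have hjc : Integrable (fun g : Matrix.unitaryGroup (Fin n) ℂ =>
      (1 / (n : ℝ)) * ‖g.1 l j‖ ^ 2 - 1 / (n : ℝ) * (1 / n)) μ := hj.sub hc
  rw [integral_sub hiji hjc, integral_sub hij hi, integral_sub hj hc,
    integral_const_mul, integral_const_mul, integral_norm_entry_sq, integral_norm_entry_sq]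
  split_ifs with h
  · subst h
    rw [integral_norm_entry_sq_sq]
    simp
    field_simp
    ring
  · rw [integral_norm_entry_sq_mul μ l i j h, integral_norm_entry_sq_sq]
    simp
    field_simp
    ring

end Haar

/-- Second moment of a random linear combination of weights that are independent of the
coefficients and have covariances `p δᵢⱼ - q`. -/
lemma integral_sq_sum_mul_le {Ω ι : Type*} [MeasurableSpace Ω] [Fintype ι] [DecidableEq ι]
    {P : Measure Ω}
    {a w : ι → Ω → ℝ} {p q : ℝ} (hq : 0 ≤ q)
    (hindep : ∀ i j, IndepFun (fun ω => a i ω * a j ω) (fun ω => w i ω * w j ω) P)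
    (ha : ∀ i j, Integrable (fun ω => a i ω * a j ω) P)
    (hw : ∀ i j, Integrable (fun ω => w i ω * w j ω) P)
    (hcov : ∀ i j, ∫ ω, w i ω * w j ω ∂P = (if i = j then p else 0) - q) :
    Integrable (fun ω => (∑ i, a i ω * w i ω) ^ 2) P ∧
      ∫ ω, (∑ i, a i ω * w i ω) ^ 2 ∂P ≤ p * ∫ ω, ∑ i, a i ω ^ 2 ∂P := by
  have hexp : ∀ ω, (∑ i, a i ω * w i ω) ^ 2
      = ∑ i, ∑ j, (a i ω * a j ω) * (w i ω * w j ω) := fun ω => by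
    rw [sq, Finset.sum_mul_sum]
    exact Finset.sum_congr rfl fun i _ => Finset.sum_congr rfl fun j _ => by ring
  have hint : ∀ i j, Integrable (fun ω => (a i ω * a j ω) * (w i ω * w j ω)) P :=
    fun i j => (hindep i j).integrable_mul (ha i j) (hw i j)
  have hval : ∀ i j, ∫ ω, (a i ω * a j ω) * (w i ω * w j ω) ∂P
      = (∫ ω, a i ω * a j ω ∂P) * ((if i = j then p else 0) - q) := fun i j => by
    rw [← hcov]
    exact (hindep i j).integral_fun_mul_eq_mul_integral (ha i j).aestronglyMeasurable
      (hw i j).aestronglyMeasurable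
  have hsq : ∫ ω, (∑ i, a i ω) ^ 2 ∂P = ∑ i, ∑ j, ∫ ω, a i ω * a j ω ∂P := by
    simp_rw [sq, Finset.sum_mul_sum]
    rw [integral_finsetSum _ fun i _ => integrable_finsetSum _ fun j _ => ha i j]
    exact Finset.sum_congr rfl fun i _ => integral_finsetSum _ fun j _ => ha i j
  have hdiag : ∫ ω, ∑ i, a i ω ^ 2 ∂P = ∑ i, ∫ ω, a i ω * a i ω ∂P := by
    simp_rw [sq]
    exact integral_finsetSum _ fun i _ => ha i i
  constructor
  · simp_rw [hexp]
    exact integrable_finsetSum _ fun i _ => integrable_finsetSum _ fun j _ => hint i j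
  · simp_rw [hexp]
    rw [integral_finsetSum _ fun i _ => integrable_finsetSum _ fun j _ => hint i j]
    simp_rw [integral_finsetSum _ fun j _ => hint _ j, hval, mul_sub, Finset.sum_sub_distrib,
      ← Finset.sum_mul, ← hsq]
    have hnonneg : 0 ≤ (∫ ω, (∑ i, a i ω) ^ 2 ∂P) * q :=
      mul_nonneg (integral_nonneg fun ω => sq_nonneg _) hq
    rw [hdiag, Finset.mul_sum]
    simp only [mul_ite, mul_zero, Finset.sum_ite_eq, Finset.mem_univ, if_true]
    rw [← Finset.sum_mul, ← Finset.mul_sum, mul_comm p]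
    linarith

/-- If `U` is Haar distributed and independent of `D`, a diagonal entry of `U D^k U^*` is close in
mean square to the normalized power sum of `D`. -/
lemma integral_sq_sum_pow_mul_centered_le {Ω : Type*} [MeasurableSpace Ω] {P : Measure Ω}
    [IsProbabilityMeasure P] {N : ℕ} {U : Ω → Matrix (Fin N) (Fin N) ℂ} {D : Ω → Fin N → ℝ}
    (hUmeas : Measurable U) (hDmeas : Measurable D)
    (hUuni : ∀ ω, U ω ∈ Matrix.unitaryGroup (Fin N) ℂ)
    (hHaar : (Measure.map (fun ω => (⟨U ω, hUuni ω⟩ : Matrix.unitaryGroup (Fin N) ℂ))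
      P).IsHaarMeasure)
    (hindep : IndepFun U D P) (l : Fin N) (k : ℕ)
    (hD : Integrable (fun ω => ∑ i, D ω i ^ (2 * k)) P) :
    Integrable (fun ω => (∑ i, D ω i ^ k * (‖U ω l i‖ ^ 2 - 1 / (N : ℝ))) ^ 2) P ∧
      ∫ ω, (∑ i, D ω i ^ k * (‖U ω l i‖ ^ 2 - 1 / (N : ℝ))) ^ 2 ∂P
        ≤ 1 / ((N : ℝ) * (N + 1)) * ∫ ω, ∑ i, D ω i ^ (2 * k) ∂P := by
  set V : Ω → Matrix.unitaryGroup (Fin N) ℂ := fun ω => ⟨U ω, hUuni ω⟩ with hV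
  have hVmeas : Measurable V := hUmeas.subtype_mk
  have : IsProbabilityMeasure (Measure.map V P) :=
    Measure.isProbabilityMeasure_map hVmeas.aemeasurable
  have : (Measure.map V P).IsMulRightInvariant :=
    isMulRightInvariant_of_isMulLeftInvariant _
  have hDi : ∀ i, Measurable fun ω => D ω i := fun i => (measurable_pi_apply i).comp hDmeas
  have hentry : ∀ i, Measurable fun A : Matrix (Fin N) (Fin N) ℂ => ‖A l i‖ ^ 2 - 1 / (N : ℝ) :=
    fun i => (((measurable_pi_apply i).comp
      (measurable_pi_apply (X := fun _ : Fin N => Fin N → ℂ) l)).norm.pow_const 2).sub_const _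
  have hcent : ∀ i, Measurable fun g : Matrix.unitaryGroup (Fin N) ℂ =>
      ‖g.1 l i‖ ^ 2 - 1 / (N : ℝ) := fun i => (hentry i).comp measurable_subtype_coe
  have hbound : ∀ (g : Matrix.unitaryGroup (Fin N) ℂ) i, |‖g.1 l i‖ ^ 2 - 1 / (N : ℝ)| ≤ 1 := by
    intro g i
    have h1 : (1 : ℝ) ≤ N := by exact_mod_cast i.pos
    have h2 : 1 / (N : ℝ) ≤ 1 := by rw [div_le_one (by linarith)]; exact h1
    have h3 : 0 ≤ 1 / (N : ℝ) := by positivity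
    have h4 := norm_entry_sq_le_one g l i
    have h5 : 0 ≤ ‖g.1 l i‖ ^ 2 := by positivity
    rw [abs_le]
    constructor <;> linarith
  have key := integral_sq_sum_mul_le (P := P) (a := fun i ω => D ω i ^ k)
    (w := fun i ω => ‖U ω l i‖ ^ 2 - 1 / (N : ℝ)) (p := 1 / ((N : ℝ) * (N + 1)))
    (q := 1 / ((N : ℝ) ^ 2 * (N + 1))) (by positivity) ?_ ?_ ?_ ?_
  · simpa only [← pow_mul, mul_comm k 2] using key
  · intro i j
    exact hindep.symm.comp
      (φ := fun d : Fin N → ℝ => d i ^ k * d j ^ k)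
      (ψ := fun A : Matrix (Fin N) (Fin N) ℂ =>
        (‖A l i‖ ^ 2 - 1 / (N : ℝ)) * (‖A l j‖ ^ 2 - 1 / (N : ℝ)))
      (((measurable_pi_apply i).pow_const k).mul ((measurable_pi_apply j).pow_const k))
      ((hentry i).mul (hentry j))
  · intro i j
    refine hD.mono' (((hDi i).pow_const k).mul ((hDi j).pow_const k)).aestronglyMeasurable
      (Filter.Eventually.of_forall fun ω => ?_)
    have hle : ∀ i, (D ω i ^ k) ^ 2 ≤ ∑ i, D ω i ^ (2 * k) := fun i => by
      rw [← pow_mul, mul_comm k 2]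
      exact Finset.single_le_sum (f := fun i => D ω i ^ (2 * k))
        (fun _ _ => (even_two_mul k).pow_nonneg _) (Finset.mem_univ i)
    rw [Real.norm_eq_abs, abs_le]
    constructor <;>
      nlinarith [hle i, hle j, sq_nonneg (D ω i ^ k - D ω j ^ k), sq_nonneg (D ω i ^ k + D ω j ^ k)]
  · intro i j
    refine integrable_of_measurable_of_bounded
      (((hentry i).comp hUmeas).mul ((hentry j).comp hUmeas)) 1 fun ω => ?_
    rw [abs_mul]
    exact mul_le_one₀ (hbound (V ω) i) (abs_nonneg _) (hbound (V ω) j)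
  · intro i j
    rw [← integral_norm_entry_sq_centered_mul (Measure.map V P) l i j]
    exact (integral_map hVmeas.aemeasurable ((hcent i).mul (hcent j)).aestronglyMeasurable).symm

open Filter in
lemma tendsto_measure_ge_of_tendsto_integral_sq {Ω : Type*} [MeasurableSpace Ω] {P : Measure Ω}
    [IsProbabilityMeasure P] {Y : ℕ → Ω → ℝ} (hint : ∀ n, Integrable (fun ω => Y n ω ^ 2) P)
    {b : ℕ → ℝ} (hb : ∀ n, ∫ ω, Y n ω ^ 2 ∂P ≤ b n) (hb0 : Tendsto b atTop (nhds 0))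
    {ε : ℝ} (hε : 0 < ε) : Tendsto (fun n => P {ω | ε ≤ |Y n ω|}) atTop (nhds 0) := by
  have hlim : Tendsto (fun n => ENNReal.ofReal (b n / ε ^ 2)) atTop (nhds 0) := by
    rw [← ENNReal.ofReal_zero]
    exact ENNReal.tendsto_ofReal (by simpa using hb0.div_const (ε ^ 2))
  refine tendsto_of_tendsto_of_tendsto_of_le_of_le tendsto_const_nhds hlim (fun _ => zero_le)
    fun n => ?_
  have hM := mul_meas_ge_le_integral_of_nonneg (μ := P)
    (Filter.Eventually.of_forall fun ω => sq_nonneg (Y n ω)) (hint n) (ε ^ 2)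
  have hset : {ω | ε ≤ |Y n ω|} = {ω | ε ^ 2 ≤ Y n ω ^ 2} := by
    ext ω
    simp only [Set.mem_ofPred_eq]
    rw [← sq_abs (Y n ω), sq_le_sq₀ hε.le (abs_nonneg _)]
  show P {ω | ε ≤ |Y n ω|} ≤ _
  rw [hset, ← ENNReal.ofReal_toReal (measure_ne_top P _)]
  refine ENNReal.ofReal_le_ofReal ?_
  rw [le_div_iff₀ (by positivity), mul_comm]
  exact hM.trans (hb n)

/-- In the setting of the rotationally invariant Hermitian random
matrices `X_N = U_N D_N U_N^*`, define random variables `Mg n k` (the moments of the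
transition measure of the Rayleigh measure `κ_N`) by the Markov–Krein recursion
`Mκ n k = k·Mg n k − Σ_{r=1}^{k−1} Mκ n r · Mg n (k−r)`.  If `sup_N E[M_k(m_N)] < ∞`
for all even `k` and the moments of `m_N` converge in probability to those of a
probability measure `m` with finite moments of all orders, then `Mg n k` converges to
`M_k(m)` in probability for every `k ≥ 1`. -/
theorem statement8
    {Ω : Type} [MeasurableSpace Ω] (Pr : Measure Ω) [IsProbabilityMeasure Pr]
    (U : (n : ℕ) → Ω → Matrix (Fin (n + 1)) (Fin (n + 1)) ℂ)
    (D : (n : ℕ) → Ω → (Fin (n + 1) → ℝ))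
    (hUmeas : ∀ n, Measurable (U n))
    (hDmeas : ∀ n, Measurable (D n))
    (hUuni : ∀ n ω, U n ω ∈ Matrix.unitaryGroup (Fin (n + 1)) ℂ)
    -- `U_N` is Haar distributed on the unitary group:
    (hHaar : ∀ n, (Measure.map
      (fun ω => (⟨U n ω, hUuni n ω⟩ : Matrix.unitaryGroup (Fin (n + 1)) ℂ)) Pr).IsHaarMeasure)
    -- `D_N` is independent of `U_N`:
    (hindep : ∀ n, IndepFun (U n) (D n) Pr)
    (X : (n : ℕ) → Ω → Matrix (Fin (n + 1)) (Fin (n + 1)) ℂ)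
    (hX : ∀ n ω, X n ω = U n ω * Matrix.diagonal (fun i => (D n ω i : ℂ)) * star (U n ω))
    -- the ordered eigenvalues `λ_1 ≤ ⋯ ≤ λ_N` of `X_N`:
    (lam : (n : ℕ) → Ω → (Fin (n + 1) → ℝ))
    (hlam_mono : ∀ n ω, Monotone (lam n ω))
    (hlam_eig : ∀ n ω, ∃ V ∈ Matrix.unitaryGroup (Fin (n + 1)) ℂ,
      X n ω = V * Matrix.diagonal (fun i => (lam n ω i : ℂ)) * star V)
    -- the ordered eigenvalues `λ̃_1 ≤ ⋯ ≤ λ̃_{N−1}` of the principal submatrix: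
    (lamt : (n : ℕ) → Ω → (Fin n → ℝ))
    (hlamt_mono : ∀ n ω, Monotone (lamt n ω))
    (hlamt_eig : ∀ n ω, ∃ V ∈ Matrix.unitaryGroup (Fin n) ℂ,
      (X n ω).submatrix Fin.castSucc Fin.castSucc
        = V * Matrix.diagonal (fun j => (lamt n ω j : ℂ)) * star V)
    -- the moments of the empirical eigenvalue distribution `m_N`:
    (Mm : ℕ → ℕ → Ω → ℝ)
    (hMm : ∀ n k ω, Mm n k ω = (1 / (n + 1 : ℝ)) * ∑ i, lam n ω i ^ k)
    (hint : ∀ n k, Integrable (Mm n k) Pr)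
    -- `sup_{N ≥ 1} E[M_k(m_N)] < ∞` for every even `k`:
    (hsup : ∀ k : ℕ, Even k → ∃ C : ℝ, ∀ n, (∫ ω, Mm n k ω ∂Pr) ≤ C)
    -- the moments of the Rayleigh measure `κ_N`:
    (Mκ : ℕ → ℕ → Ω → ℝ)
    (hMκ : ∀ n k ω, Mκ n k ω = (∑ i, lam n ω i ^ k) - ∑ j, lamt n ω j ^ k)
    -- the limiting probability measure `m`, with finite moments of all orders:
    (m : Measure ℝ) [IsProbabilityMeasure m]
    (hm : ∀ j : ℕ, Integrable (fun x => x ^ j) m)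
    -- the moments `Mg n k` of the transition measure `g_N` of `κ_N`, defined by the
    -- Markov–Krein recursion from the moments of `κ_N`:
    (Mg : ℕ → ℕ → Ω → ℝ)
    (hMg : ∀ n ω, ∀ j : ℕ, 1 ≤ j → Mκ n j ω
      = j * Mg n j ω - ∑ r ∈ Finset.Ico 1 j, Mκ n r ω * Mg n (j - r) ω)
    -- the moments of `m_N` converge to those of `m` in probability:
    (hconv : ∀ j : ℕ, 1 ≤ j → ∀ ε : ℝ, 0 < ε →
      Filter.Tendsto (fun n => Pr {ω | ε ≤ |Mm n j ω - ∫ x, x ^ j ∂m|})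
        Filter.atTop (nhds 0))
    (k : ℕ) (hk : 1 ≤ k) (ε : ℝ) (hε : 0 < ε) :
    Filter.Tendsto (fun n => Pr {ω | ε ≤ |Mg n k ω - ∫ x, x ^ k ∂m|})
      Filter.atTop (nhds 0) := by
  have hsum : ∀ n j ω, ∑ i, lam n ω i ^ j = ∑ i, D n ω i ^ j := by
    intro n j ω
    obtain ⟨V, hV, hXV⟩ := hlam_eig n ω
    have h1 := pow_of_unitary_diagonal hV hXV j
    rw [pow_of_unitary_diagonal (hUuni n ω) (hX n ω) j] at h1
    have h2 := congrArg Matrix.trace h1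
    simp only [← Complex.ofReal_pow] at h2
    rw [trace_conj_diagonal (hUuni n ω) fun i => D n ω i ^ j,
      trace_conj_diagonal hV fun i => lam n ω i ^ j] at h2
    exact_mod_cast h2.symm
  have hcorner : ∀ n j ω, (X n ω ^ j) (Fin.last n) (Fin.last n)
      = ((∑ i, D n ω i ^ j * ‖U n ω (Fin.last n) i‖ ^ 2 : ℝ) : ℂ) := by
    intro n j ω
    rw [pow_of_unitary_diagonal (hUuni n ω) (hX n ω) j,
      ← diagonal_conj_apply_self (U n ω) fun i => D n ω i ^ j]
    simp only [Complex.ofReal_pow]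
  have hMg' : ∀ n ω, Mg n k ω = ∑ i, D n ω i ^ k * ‖U n ω (Fin.last n) i‖ ^ 2 := by
    intro n ω
    refine eq_of_markovKrein_recursion (κ := fun j => Mκ n j ω) (g := fun j => Mg n j ω)
      (c := fun j => ∑ i, D n ω i ^ j * ‖U n ω (Fin.last n) i‖ ^ 2) ?_ ?_ (hMg n ω) k hk
    · simp [sum_norm_sq_row_of_unitary (hUuni n ω)]
    · intro j
      obtain ⟨V, hV, hXV⟩ := hlam_eig n ω
      obtain ⟨W, hW, hXW⟩ := hlamt_eig n ω
      have h := corner_pow_recursion hV hXV hW hXW j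
      simp only [hcorner] at h
      simp only [hMκ]
      exact_mod_cast h
  have hMm' : ∀ n j ω, ∑ i, D n ω i ^ j = (n + 1 : ℝ) * Mm n j ω := by
    intro n j ω
    rw [hMm, hsum]
    field_simp
  have hdiff : ∀ n ω, Mg n k ω - Mm n k ω
      = ∑ i, D n ω i ^ k * (‖U n ω (Fin.last n) i‖ ^ 2 - 1 / ((n + 1 : ℕ) : ℝ)) := by
    intro n ω
    simp only [mul_sub, Finset.sum_sub_distrib, ← Finset.sum_mul]
    rw [hMg', hMm, hsum]
    push_cast
    ring
  obtain ⟨C, hC⟩ := hsup (2 * k) (even_two_mul k)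
  have hsq : ∀ n, Integrable (fun ω => (Mg n k ω - Mm n k ω) ^ 2) Pr ∧
      ∫ ω, (Mg n k ω - Mm n k ω) ^ 2 ∂Pr ≤ C * (1 / (((n + 1 : ℕ) : ℝ) + 1)) := by
    intro n
    simp_rw [hdiff]
    have hD : Integrable (fun ω => ∑ i, D n ω i ^ (2 * k)) Pr := by
      simp_rw [hMm']
      exact (hint n (2 * k)).const_mul _
    obtain ⟨h1, h2⟩ := integral_sq_sum_pow_mul_centered_le (hUmeas n) (hDmeas n) (hUuni n)
      (hHaar n) (hindep n) (Fin.last n) k hD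
    refine ⟨h1, h2.trans ?_⟩
    simp_rw [hMm', integral_const_mul]
    have h3 : 1 / (((n + 1 : ℕ) : ℝ) * ((n + 1 : ℕ) + 1))
        * ((n + 1 : ℝ) * ∫ ω, Mm n (2 * k) ω ∂Pr)
        = (∫ ω, Mm n (2 * k) ω ∂Pr) * (1 / (((n + 1 : ℕ) : ℝ) + 1)) := by
      push_cast
      field_simp
    rw [h3]
    exact mul_le_mul_of_nonneg_right (hC n) (by positivity)
  have hb0 : Filter.Tendsto (fun n : ℕ => C * (1 / (((n + 1 : ℕ) : ℝ) + 1)))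
      Filter.atTop (nhds 0) := by
    simpa using ((Filter.tendsto_add_atTop_iff_nat 1).mpr
      (tendsto_one_div_add_atTop_nhds_zero_nat (𝕜 := ℝ))).const_mul C
  have hlim := (tendsto_measure_ge_of_tendsto_integral_sq (fun n => (hsq n).1)
    (fun n => (hsq n).2) hb0 (half_pos hε)).add (hconv k hk (ε / 2) (half_pos hε))
  rw [add_zero] at hlim
  refine tendsto_of_tendsto_of_tendsto_of_le_of_le tendsto_const_nhds hlim (fun _ => zero_le)
    fun n => (measure_mono fun ω hω => ?_).trans (measure_union_le _ _)
  by_contra hcon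
  simp only [Set.mem_union, Set.mem_ofPred_eq, not_or, not_le] at hcon hω
  have := abs_sub_le (Mg n k ω) (Mm n k ω) (∫ x, x ^ k ∂m)
  linarith [hcon.1, hcon.2]
end

section
/- Let p and p_n (n ≥ 1) be random probability measures on ℝ, defined on a common probability space, such that almost surely p and all p_n have finite moments of all orders, and almost surely the moment sequence {M_k(p)}_{k≥1} is determinate. If for every k ≥ 1 and every ε > 0, P(|M_k(p_n) − M_k(p)| ≥ ε) → 0 as n → ∞, then there exist a strictly increasing sequence n(1) < n(2) < ⋯ of indices and an event of probability 1 on which p_{n(ℓ)} converges weakly to p as ℓ → ∞. -/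
open MeasureTheory Finset

open Filter Topology ENNReal BoundedContinuousFunction

theorem lintegral_sq_le_of_tendsto {μ : ℕ → ProbabilityMeasure ℝ} {ν : ProbabilityMeasure ℝ}
    (h : Tendsto μ atTop (𝓝 ν)) {f : ℝ → ℝ} (hf : Continuous f)
    (hf2 : ∀ n, Integrable (fun x => f x ^ 2) (μ n : Measure ℝ)) {C : ℝ}
    (hC : ∀ n, ∫ x, f x ^ 2 ∂(μ n : Measure ℝ) ≤ C) :
    ∫⁻ x, ENNReal.ofReal (f x ^ 2) ∂(ν : Measure ℝ) ≤ ENNReal.ofReal C := by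
  refine (lintegral_le_liminf_lintegral_of_forall_isOpen_measure_le_liminf_measure
    (μs := fun n => (μ n : Measure ℝ)) (hf.pow 2) (fun x => sq_nonneg (f x)) fun G hG =>
      ProbabilityMeasure.le_liminf_measure_open_of_tendsto h hG).trans ?_
  refine liminf_le_of_le (by isBoundedDefault) fun b hb => ?_
  obtain ⟨n, hn⟩ := hb.exists
  refine hn.trans ?_
  change ∫⁻ x, ENNReal.ofReal (f x ^ 2) ∂(μ n : Measure ℝ) ≤ _
  rw [← ofReal_integral_eq_lintegral_ofReal (hf2 n) (ae_of_all _ fun x => sq_nonneg (f x))]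
  exact ENNReal.ofReal_le_ofReal (hC n)

theorem integrable_sq_of_tendsto {μ : ℕ → ProbabilityMeasure ℝ} {ν : ProbabilityMeasure ℝ}
    (h : Tendsto μ atTop (𝓝 ν)) {f : ℝ → ℝ} (hf : Continuous f)
    (hf2 : ∀ n, Integrable (fun x => f x ^ 2) (μ n : Measure ℝ)) {C : ℝ}
    (hC : ∀ n, ∫ x, f x ^ 2 ∂(μ n : Measure ℝ) ≤ C) :
    Integrable (fun x => f x ^ 2) (ν : Measure ℝ) :=
  (lintegral_ofReal_ne_top_iff_integrable (hf.pow 2).aestronglyMeasurable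
    (ae_of_all _ fun x => sq_nonneg (f x))).1
    ((lintegral_sq_le_of_tendsto h hf hf2 hC).trans_lt ENNReal.ofReal_lt_top).ne

theorem integral_sq_le_of_tendsto {μ : ℕ → ProbabilityMeasure ℝ} {ν : ProbabilityMeasure ℝ}
    (h : Tendsto μ atTop (𝓝 ν)) {f : ℝ → ℝ} (hf : Continuous f)
    (hf2 : ∀ n, Integrable (fun x => f x ^ 2) (μ n : Measure ℝ)) {C : ℝ}
    (hC : ∀ n, ∫ x, f x ^ 2 ∂(μ n : Measure ℝ) ≤ C) :
    ∫ x, f x ^ 2 ∂(ν : Measure ℝ) ≤ C := by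
  have hC0 : 0 ≤ C := (integral_nonneg fun x => sq_nonneg (f x)).trans (hC 0)
  rw [integral_eq_lintegral_of_nonneg_ae (ae_of_all _ fun x => sq_nonneg (f x))
    (hf.pow 2).aestronglyMeasurable]
  exact ENNReal.toReal_le_of_le_ofReal hC0 (lintegral_sq_le_of_tendsto h hf hf2 hC)

theorem integrable_of_integrable_sq {ν : Measure ℝ} [IsFiniteMeasure ν] {f : ℝ → ℝ}
    (hf : Continuous f) (hf2 : Integrable (fun x => f x ^ 2) ν) : Integrable f ν :=
  ((memLp_two_iff_integrable_sq hf.aestronglyMeasurable).2 hf2).integrable (by norm_num)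

/-- Truncation of a function to the interval `[-R, R]`. -/
def truncation (f : ℝ → ℝ) (R : ℝ) (x : ℝ) : ℝ := max (-R) (min R (f x))

theorem continuous_truncation {f : ℝ → ℝ} (hf : Continuous f) (R : ℝ) :
    Continuous (truncation f R) := by
  unfold truncation
  fun_prop

theorem abs_truncation_le (f : ℝ → ℝ) {R : ℝ} (hR : 0 ≤ R) (x : ℝ) :
    |truncation f R x| ≤ R :=
  abs_le.2 ⟨le_max_left _ _, max_le (by linarith) (min_le_left _ _)⟩

theorem abs_sub_truncation_le (f : ℝ → ℝ) {R : ℝ} (hR : 0 < R) (x : ℝ) :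
    |f x - truncation f R x| ≤ f x ^ 2 / R := by
  rw [le_div_iff₀ hR, truncation]
  rcases le_total R (f x) with h | h
  · rw [min_eq_left h, max_eq_right (by linarith), abs_of_nonneg (by linarith)]
    nlinarith
  · rw [min_eq_right h]
    rcases le_total (-R) (f x) with h' | h'
    · rw [max_eq_right h']
      simpa using sq_nonneg (f x)
    · rw [max_eq_left h', abs_of_nonpos (by linarith)]
      nlinarith

theorem abs_integral_sub_integral_truncation_le {ν : Measure ℝ} [IsFiniteMeasure ν] {f : ℝ → ℝ}
    (hf : Continuous f) (hf2 : Integrable (fun x => f x ^ 2) ν) {C : ℝ}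
    (hC : ∫ x, f x ^ 2 ∂ν ≤ C) {R : ℝ} (hR : 0 < R) :
    |∫ x, f x ∂ν - ∫ x, truncation f R x ∂ν| ≤ C / R := by
  have htr : Integrable (truncation f R) ν :=
    .of_bound (continuous_truncation hf R).aestronglyMeasurable R
      (ae_of_all _ (abs_truncation_le f hR.le))
  rw [← integral_sub (integrable_of_integrable_sq hf hf2) htr]
  calc |∫ x, (f x - truncation f R x) ∂ν| = ‖∫ x, (f x - truncation f R x) ∂ν‖ :=
        (Real.norm_eq_abs _).symm
    _ ≤ ∫ x, f x ^ 2 / R ∂ν :=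
        norm_integral_le_of_norm_le (hf2.div_const R) (ae_of_all _ (abs_sub_truncation_le f hR))
    _ = (∫ x, f x ^ 2 ∂ν) / R := integral_div _ _
    _ ≤ C / R := by gcongr

/-- Along a weakly convergent sequence of probability measures, the integrals of a continuous
function with uniformly bounded second moments converge. -/
theorem tendsto_integral_of_integral_sq_le {μ : ℕ → ProbabilityMeasure ℝ}
    {ν : ProbabilityMeasure ℝ} (h : Tendsto μ atTop (𝓝 ν)) {f : ℝ → ℝ} (hf : Continuous f)
    (hf2 : ∀ n, Integrable (fun x => f x ^ 2) (μ n : Measure ℝ)) {C : ℝ}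
    (hC : ∀ n, ∫ x, f x ^ 2 ∂(μ n : Measure ℝ) ≤ C) :
    Tendsto (fun n => ∫ x, f x ∂(μ n : Measure ℝ)) atTop (𝓝 (∫ x, f x ∂(ν : Measure ℝ))) := by
  have hC0 : 0 ≤ C := (integral_nonneg fun x => sq_nonneg (f x)).trans (hC 0)
  rw [Metric.tendsto_atTop']
  intro ε hε
  set R : ℝ := 3 * (C + 1) / ε
  have hR : 0 < R := by positivity
  have hCR : C / R < ε / 3 := by
    rw [div_lt_div_iff₀ hR (by norm_num)]
    have : ε * R = 3 * (C + 1) := by simp only [R]; field_simp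
    linarith
  let g : ℝ →ᵇ ℝ := BoundedContinuousFunction.ofNormedAddCommGroup (truncation f R)
    (continuous_truncation hf R) R (abs_truncation_le f hR.le)
  have hg := ProbabilityMeasure.tendsto_iff_forall_integral_tendsto.1 h g
  obtain ⟨N, hN⟩ := Metric.tendsto_atTop'.1 hg (ε / 3) (by positivity)
  refine ⟨N, fun n hn => ?_⟩
  have h1 := abs_integral_sub_integral_truncation_le hf (hf2 n) (hC n) hR
  have h2 := abs_integral_sub_integral_truncation_le hf (integrable_sq_of_tendsto h hf hf2 hC)
    (integral_sq_le_of_tendsto h hf hf2 hC) hR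
  have h3 : |∫ x, truncation f R x ∂(μ n : Measure ℝ)
      - ∫ x, truncation f R x ∂(ν : Measure ℝ)| < ε / 3 := hN n hn
  rw [Real.dist_eq]
  rw [abs_le] at h1 h2
  rw [abs_lt] at h3 ⊢
  constructor <;> linarith

/-- A family of probability measures on `ℝ` with uniformly bounded second moments is tight. -/
theorem isTightMeasureSet_of_integral_sq_le {S : Set (Measure ℝ)}
    (hS : ∀ μ ∈ S, IsProbabilityMeasure μ)
    (hint : ∀ μ ∈ S, Integrable (fun x : ℝ => x ^ 2) μ) {C : ℝ}
    (hC : ∀ μ ∈ S, ∫ x, x ^ 2 ∂μ ≤ C) : IsTightMeasureSet S := by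
  refine isTightMeasureSet_of_tendsto_measure_norm_gt ?_
  have hlim : Tendsto (fun r : ℝ => ENNReal.ofReal (C / r ^ 2)) atTop (𝓝 0) := by
    rw [← ENNReal.ofReal_zero]
    exact ENNReal.tendsto_ofReal (tendsto_const_nhds.div_atTop (tendsto_pow_atTop two_ne_zero))
  refine tendsto_of_tendsto_of_tendsto_of_le_of_le' tendsto_const_nhds hlim
    (Eventually.of_forall fun _ => zero_le) ?_
  filter_upwards [eventually_gt_atTop 0] with r hr
  refine iSup₂_le fun μ hμ => ?_
  have := hS μ hμ
  have hmarkov := mul_meas_ge_le_integral_of_nonneg (ae_of_all μ fun x : ℝ => sq_nonneg x)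
    (hint μ hμ) (r ^ 2)
  calc μ {x | r < ‖x‖} ≤ μ {x | r ^ 2 ≤ x ^ 2} := by
        refine measure_mono fun x hx => ?_
        have hx' : r < |x| := hx
        show r ^ 2 ≤ x ^ 2
        rw [← sq_abs x]
        gcongr
    _ = ENNReal.ofReal (μ.real {x | r ^ 2 ≤ x ^ 2}) := by simp
    _ ≤ ENNReal.ofReal (C / r ^ 2) := by
        refine ENNReal.ofReal_le_ofReal ?_
        rw [le_div_iff₀ (by positivity), mul_comm]
        exact hmarkov.trans (hC μ hμ)

/-- The method of moments: convergence of moments to a determinate moment sequence implies weak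
convergence. -/
theorem tendsto_of_tendsto_moments {μ : ℕ → ProbabilityMeasure ℝ} {ν : ProbabilityMeasure ℝ}
    (hμ : ∀ n (k : ℕ), Integrable (fun x : ℝ => x ^ k) (μ n : Measure ℝ))
    (hdet : ∀ ρ : Measure ℝ, IsProbabilityMeasure ρ →
      (∀ k : ℕ, Integrable (fun x => x ^ k) ρ) →
      (∀ k : ℕ, 1 ≤ k → (∫ x, x ^ k ∂ρ) = ∫ x, x ^ k ∂(ν : Measure ℝ)) → ρ = ν)
    (hlim : ∀ k : ℕ, 1 ≤ k → Tendsto (fun n => ∫ x, x ^ k ∂(μ n : Measure ℝ)) atTop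
      (𝓝 (∫ x, x ^ k ∂(ν : Measure ℝ)))) :
    Tendsto μ atTop (𝓝 ν) := by
  have hbdd : ∀ k : ℕ, ∃ C, ∀ n, ∫ x, (x ^ k) ^ 2 ∂(μ n : Measure ℝ) ≤ C := by
    intro k
    rcases Nat.eq_zero_or_pos k with rfl | hk
    · exact ⟨1, fun n => by simp⟩
    · obtain ⟨C, hC⟩ := (hlim (k * 2) (by lia)).bddAbove_range
      exact ⟨C, fun n => by simpa only [← pow_mul] using hC ⟨n, rfl⟩⟩
  have hsq : ∀ n k, Integrable (fun x : ℝ => (x ^ k) ^ 2) (μ n : Measure ℝ) := fun n k => by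
    simpa only [← pow_mul] using hμ n (k * 2)
  have htight : IsTightMeasureSet {((ρ : ProbabilityMeasure ℝ) : Measure ℝ) | ρ ∈ Set.range μ} := by
    obtain ⟨C, hC⟩ := hbdd 1
    refine isTightMeasureSet_of_integral_sq_le (C := C) ?_ ?_ ?_
    · rintro _ ⟨ρ, -, rfl⟩
      infer_instance
    · rintro _ ⟨_, ⟨n, rfl⟩, rfl⟩
      exact hμ n 2
    · rintro _ ⟨_, ⟨n, rfl⟩, rfl⟩
      simpa using hC n
  have hcomp := isCompact_closure_of_isTightMeasureSet htight
  refine tendsto_of_subseq_tendsto fun ns hns => ?_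
  obtain ⟨ρ, -, ms, hms, hρ⟩ :=
    hcomp.tendsto_subseq fun n => subset_closure (Set.mem_range_self (f := μ) (ns n))
  refine ⟨ms, ?_⟩
  suffices ρ = ν by simpa [this, Function.comp_def] using hρ
  refine Subtype.ext (hdet ρ inferInstance (fun k => ?_) fun k hk => ?_) <;>
    obtain ⟨C, hC⟩ := hbdd k
  · exact integrable_of_integrable_sq (by fun_prop) (integrable_sq_of_tendsto hρ
      (f := fun x => x ^ k) (by fun_prop) (fun n => hsq _ k) fun n => hC _)
  · exact tendsto_nhds_unique (tendsto_integral_of_integral_sq_le hρ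
      (f := fun x => x ^ k) (by fun_prop) (fun n => hsq _ k) fun n => hC _)
      ((hlim k hk).comp (hns.comp hms.tendsto_atTop))

/-- A countable family of sequences converging to zero in measure admits a common subsequence
converging to zero almost everywhere. -/
theorem exists_strictMono_ae_tendsto_zero {Ω : Type*} [MeasurableSpace Ω] {Pr : Measure Ω}
    {d : ℕ → ℕ → Ω → ℝ}
    (hd : ∀ k, ∀ ε : ℝ, 0 < ε → Tendsto (fun n => Pr {ω | ε ≤ |d k n ω|}) atTop (𝓝 0)) :
    ∃ φ : ℕ → ℕ, StrictMono φ ∧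
      ∀ᵐ ω ∂Pr, ∀ k, Tendsto (fun ℓ => d k (φ ℓ) ω) atTop (𝓝 0) := by
  obtain ⟨u, hu, hsum⟩ := ENNReal.exists_pos_sum_of_countable' one_ne_zero ℕ
  let B : ℕ → ℕ → Set Ω := fun m n =>
    ⋃ k ∈ Finset.range (m + 1), {ω | 1 / ((m : ℝ) + 1) ≤ |d k n ω|}
  have hB : ∀ m, ∀ᶠ n in atTop, Pr (B m n) ≤ u m := by
    intro m
    have hlim : Tendsto (fun n => ∑ k ∈ Finset.range (m + 1),
        Pr {ω | 1 / ((m : ℝ) + 1) ≤ |d k n ω|}) atTop (𝓝 0) := by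
      simpa using tendsto_finsetSum (Finset.range (m + 1))
        fun k _ => hd k (1 / ((m : ℝ) + 1)) (by positivity)
    filter_upwards [hlim.eventually_lt_const (hu m)] with n hn
    exact (measure_biUnion_finset_le _ _).trans hn.le
  obtain ⟨φ, hφ, hφB⟩ := extraction_forall_of_eventually hB
  refine ⟨φ, hφ, ?_⟩
  have hfin : ∑' m, Pr (B m (φ m)) ≠ ∞ :=
    ((ENNReal.tsum_le_tsum hφB).trans_lt (hsum.trans ENNReal.one_lt_top)).ne
  filter_upwards [ae_eventually_notMem hfin] with ω hω k
  refine squeeze_zero_norm' ?_ tendsto_one_div_add_atTop_nhds_zero_nat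
  filter_upwards [hω, eventually_ge_atTop k] with m hm hkm
  by_contra! hlt
  exact hm (Set.mem_biUnion (Finset.mem_coe.2 (Finset.mem_range.2 (by lia))) hlt.le)

/-- Let `p` and `p_n` be random probability measures on `ℝ` on a
common probability space such that almost surely all of them have finite moments of
all orders and the moment sequence of `p` is determinate.  If the moments of `p_n`
converge to those of `p` in probability, then there is a strictly increasing sequence
of indices `n(1) < n(2) < ⋯` and an event of probability 1 on which `p_{n(ℓ)}`
converges weakly to `p` as `ℓ → ∞`. -/
theorem statement13
    {Ω : Type} [MeasurableSpace Ω] (Pr : Measure Ω) [IsProbabilityMeasure Pr]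
    (p : Ω → Measure ℝ) (pn : ℕ → Ω → Measure ℝ)
    (hp : ∀ ω, IsProbabilityMeasure (p ω))
    (hpn : ∀ n ω, IsProbabilityMeasure (pn n ω))
    (hpmeas : Measurable p) (hpnmeas : ∀ n, Measurable (pn n))
    -- almost surely: all moments are finite and the moment problem for `p` is determinate
    (hae : ∀ᵐ ω ∂Pr,
      (∀ k : ℕ, Integrable (fun x => x ^ k) (p ω)) ∧
      (∀ n, ∀ k : ℕ, Integrable (fun x => x ^ k) (pn n ω)) ∧
      (∀ μ : Measure ℝ, IsProbabilityMeasure μ →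
        (∀ k : ℕ, Integrable (fun x => x ^ k) μ) →
        (∀ k : ℕ, 1 ≤ k → (∫ x, x ^ k ∂μ) = ∫ x, x ^ k ∂(p ω)) → μ = p ω))
    -- the moments of `p_n` converge to those of `p` in probability:
    (hconv : ∀ k : ℕ, 1 ≤ k → ∀ ε : ℝ, 0 < ε →
      Filter.Tendsto
        (fun n => Pr {ω | ε ≤ |(∫ x, x ^ k ∂(pn n ω)) - ∫ x, x ^ k ∂(p ω)|})
        Filter.atTop (nhds 0))
    :
    ∃ φ : ℕ → ℕ, StrictMono φ ∧ ∃ S : Set Ω, Pr S = 1 ∧ ∀ ω ∈ S,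
      ∀ f : ℝ → ℝ, Continuous f → (∃ C : ℝ, ∀ x, |f x| ≤ C) →
        Filter.Tendsto (fun ℓ => ∫ x, f x ∂(pn (φ ℓ) ω))
          Filter.atTop (nhds (∫ x, f x ∂(p ω))) := by
  obtain ⟨φ, hφ, hlim⟩ := exists_strictMono_ae_tendsto_zero (Pr := Pr)
    (d := fun k n ω => (∫ x, x ^ (k + 1) ∂(pn n ω)) - ∫ x, x ^ (k + 1) ∂(p ω))
    fun k => hconv (k + 1) (by lia)
  have hweak : ∀ᵐ ω ∂Pr, ∀ f : ℝ → ℝ, Continuous f → (∃ C : ℝ, ∀ x, |f x| ≤ C) →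
      Tendsto (fun ℓ => ∫ x, f x ∂(pn (φ ℓ) ω)) atTop (𝓝 (∫ x, f x ∂(p ω))) := by
    filter_upwards [hae, hlim] with ω ⟨_, hint, hdet⟩ hω
    have hconv' := tendsto_of_tendsto_moments (μ := fun ℓ => ⟨pn (φ ℓ) ω, hpn (φ ℓ) ω⟩)
      (ν := ⟨p ω, hp ω⟩) (fun ℓ => hint (φ ℓ)) hdet fun k hk => by
        obtain ⟨j, rfl⟩ := Nat.exists_eq_add_of_le' hk
        exact tendsto_sub_nhds_zero_iff.1 (hω j)
    rintro f hf ⟨C, hC⟩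
    exact ProbabilityMeasure.tendsto_iff_forall_integral_tendsto.1 hconv'
      (BoundedContinuousFunction.ofNormedAddCommGroup f hf C hC)
  obtain ⟨S, hS, hSweak⟩ := hweak.exists_mem
  exact ⟨φ, hφ, S, by rw [measure_congr (eventuallyEq_univ.2 hS), measure_univ], hSweak⟩
end

section
/- Fix N ≥ 1 and k ≥ 1, and let I be the N×N identity matrix, P = diag(1,…,1,0) and Q = diag(0,…,0,1), so I = P + Q. Let γ_k^{(1)} = (1,…,k)(k+1)⋯(2k) and γ_k^{(2)} = (1)⋯(k)(k+1,…,2k) in the symmetric group S_{2k}, and for π ∈ S_{2k} define 𝒯_k(π) = Tr_{π^{-1}γ_k^{(1)}γ_k^{(2)}}[I^k, I^k] − Tr_{π^{-1}γ_k^{(1)}γ_k^{(2)}}[I^k, P^k] − Tr_{π^{-1}γ_k^{(1)}γ_k^{(2)}}[P^k, I^k] + Tr_{π^{-1}γ_k^{(1)}γ_k^{(2)}}[P^k, P^k]. Then for every π ∈ S_{2k}, 𝒯_k(π) = Σ_{i=1}^{k} Σ_{j=1}^{k} Tr_{π^{-1}γ_k^{(1)}γ_k^{(2)}}[I^{k−i},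 Q, P^{i−1}, I^{k−j}, Q, P^{j−1}], where the 2k matrix arguments are listed in order. -/
open Finset

/-- `Tr_σ[A_1, …, A_m]`: the product over the cycles `(i_1, …, i_p)` of the
permutation `σ` of the traces `Tr(A_{i_1} A_{i_2} ⋯ A_{i_p})`.  It is given by the
standard closed formula `Σ_{j : ι → Fin N} Π_i (A_i)_{j(i), j(σ(i))}`. -/
noncomputable def trPerm {ι : Type*} [Fintype ι] [DecidableEq ι] {N : ℕ}
    (σ : Equiv.Perm ι) (A : ι → Matrix (Fin N) (Fin N) ℂ) : ℂ :=
  ∑ j : ι → Fin N, ∏ i, A i (j i) (j (σ i))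

/-- The projection `P = diag(1, …, 1, 0)`. -/
noncomputable def Pmat (N : ℕ) : Matrix (Fin N) (Fin N) ℂ :=
  Matrix.diagonal (fun x => if (x : ℕ) + 1 = N then 0 else 1)

/-- The projection `Q = diag(0, …, 0, 1)`, so that `I = P + Q`. -/
noncomputable def Qmat (N : ℕ) : Matrix (Fin N) (Fin N) ℂ :=
  Matrix.diagonal (fun x => if (x : ℕ) + 1 = N then 1 else 0)

/-- `γ_k^{(1)} = (1, …, k)(k+1) ⋯ (2k) ∈ S_{2k}` (on `Fin (k+k)`, zero-based). -/
def gammaOne (k : ℕ) : Equiv.Perm (Fin (k + k)) :=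
  (Equiv.permCongr finSumFinEquiv) (Equiv.sumCongr (finRotate k) (Equiv.refl (Fin k)))

/-- `γ_k^{(2)} = (1) ⋯ (k)(k+1, …, 2k) ∈ S_{2k}` (on `Fin (k+k)`, zero-based). -/
def gammaTwo (k : ℕ) : Equiv.Perm (Fin (k + k)) :=
  (Equiv.permCongr finSumFinEquiv) (Equiv.sumCongr (Equiv.refl (Fin k)) (finRotate k))

/-- The list of `2k` matrix arguments `[A^k, B^k]`. -/
noncomputable def listAB (N k : ℕ) (A B : Matrix (Fin N) (Fin N) ℂ) :
    Fin (k + k) → Matrix (Fin N) (Fin N) ℂ :=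
  fun a => if (a : ℕ) < k then A else B

/-- The list of `2k` matrix arguments `[I^{k−i}, Q, P^{i−1}, I^{k−j}, Q, P^{j−1}]`
(for `1 ≤ i, j ≤ k`). -/
noncomputable def listIQP (N k i j : ℕ) :
    Fin (k + k) → Matrix (Fin N) (Fin N) ℂ :=
  fun a =>
    if (a : ℕ) < k then
      (if (a : ℕ) < k - i then 1 else if (a : ℕ) = k - i then Qmat N else Pmat N)
    else
      (if (a : ℕ) - k < k - j then 1 else if (a : ℕ) - k = k - j then Qmat N else Pmat N)

/-- The identity matrix is `P + Q`, entrywise. -/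
lemma Pmat_add_Qmat_apply (N : ℕ) (x y : Fin N) :
    Pmat N x y + Qmat N x y = (1 : Matrix (Fin N) (Fin N) ℂ) x y := by
  by_cases h : x = y
  · subst h
    by_cases hx : (x : ℕ) + 1 = N <;> simp [Pmat, Qmat, hx]
  · simp [Pmat, Qmat, h]

lemma sum_Icc_one_sub (k : ℕ) (F : ℕ → ℂ) :
    ∑ i ∈ Finset.Icc 1 k, F (k - i) = ∑ m : Fin k, F m := by
  rw [Fin.sum_univ_eq_sum_range]
  refine Finset.sum_nbij' (fun i => k - i) (fun i => k - i) ?_ ?_ ?_ ?_ fun _ _ => rfl <;>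
    · intro i hi
      simp only [Finset.mem_Icc, Finset.mem_range] at hi ⊢
      omega

/-- Telescoping of a difference of two ordered products. -/
lemma prod_sub_prod_eq_sum_Icc (k : ℕ) (a p q : Fin k → ℂ) (h : ∀ m, p m + q m = a m) :
    ∏ m, a m - ∏ m, p m = ∑ i ∈ Finset.Icc 1 k, ∏ m : Fin k,
      (if (m : ℕ) < k - i then a m else if (m : ℕ) = k - i then q m else p m) := by
  rw [sum_Icc_one_sub k (fun n => ∏ m : Fin k,
    (if (m : ℕ) < n then a m else if (m : ℕ) = n then q m else p m))]
  have key := Finset.prod_add_ordered Finset.univ p q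
  simp only [h] at key
  rw [key, add_sub_cancel_left]
  refine Finset.sum_congr rfl fun i _ => ?_
  rw [Finset.prod_filter, Finset.prod_filter,
    ← Fintype.prod_ite_eq i q, ← Finset.prod_mul_distrib, ← Finset.prod_mul_distrib]
  refine Finset.prod_congr rfl fun m _ => ?_
  rcases lt_trichotomy m i with hm | rfl | hm
  · simp [hm, hm.ne', hm.not_gt]
  · simp
  · have h1 : ¬ (m : ℕ) < i := by simpa using hm.le
    have h2 : (m : ℕ) ≠ i := Fin.val_ne_of_ne hm.ne'
    simp [hm, hm.ne, hm.not_gt, h1, h2]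

/-- With `I = P + Q` as above and
`𝒯_k(π) = Tr_{π⁻¹γ¹γ²}[I^k, I^k] − Tr_{π⁻¹γ¹γ²}[I^k, P^k] − Tr_{π⁻¹γ¹γ²}[P^k, I^k]
+ Tr_{π⁻¹γ¹γ²}[P^k, P^k]`, for every `π ∈ S_{2k}`:
`𝒯_k(π) = Σ_{i=1}^k Σ_{j=1}^k Tr_{π⁻¹γ¹γ²}[I^{k−i}, Q, P^{i−1}, I^{k−j}, Q, P^{j−1}]`. -/
theorem statement14 (N k : ℕ) (hN : 1 ≤ N) (hk : 1 ≤ k)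
    (π : Equiv.Perm (Fin (k + k))) :
    trPerm (π⁻¹ * (gammaOne k * gammaTwo k)) (listAB N k 1 1)
        - trPerm (π⁻¹ * (gammaOne k * gammaTwo k)) (listAB N k 1 (Pmat N))
        - trPerm (π⁻¹ * (gammaOne k * gammaTwo k)) (listAB N k (Pmat N) 1)
        + trPerm (π⁻¹ * (gammaOne k * gammaTwo k)) (listAB N k (Pmat N) (Pmat N))
      = ∑ i ∈ Finset.Icc 1 k, ∑ j ∈ Finset.Icc 1 k,
          trPerm (π⁻¹ * (gammaOne k * gammaTwo k)) (listIQP N k i j) := by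
  generalize π⁻¹ * (gammaOne k * gammaTwo k) = σ
  simp only [trPerm]
  rw [← Finset.sum_sub_distrib, ← Finset.sum_sub_distrib, ← Finset.sum_add_distrib]
  simp_rw [Finset.sum_comm (s := Finset.Icc 1 k) (t := Finset.univ)]
  refine Finset.sum_congr rfl fun v _ => ?_
  have split (a p : Fin k → ℂ) (b r : Fin k → ℂ) :
      (∏ m, a m) * (∏ m, b m) - (∏ m, a m) * (∏ m, r m) - (∏ m, p m) * (∏ m, b m)
        + (∏ m, p m) * (∏ m, r m) = (∏ m, a m - ∏ m, p m) * (∏ m, b m - ∏ m, r m) := by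
    ring
  simp only [Fin.prod_univ_add, listAB, listIQP, Fin.val_castAdd, Fin.val_natAdd, Fin.is_lt,
    if_true, not_lt.mpr (Nat.le_add_right k _), if_false, Nat.add_sub_cancel_left]
  rw [split,
    prod_sub_prod_eq_sum_Icc k _ _
      (fun m => Qmat N (v (Fin.castAdd k m)) (v (σ (Fin.castAdd k m))))
      (fun m => Pmat_add_Qmat_apply N _ _),
    prod_sub_prod_eq_sum_Icc k _ _
      (fun m => Qmat N (v (Fin.natAdd k m)) (v (σ (Fin.natAdd k m))))
      (fun m => Pmat_add_Qmat_apply N _ _),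
    Finset.sum_mul_sum]
  refine Finset.sum_congr rfl fun i _ => Finset.sum_congr rfl fun j _ => ?_
  congr 1 <;> refine Finset.prod_congr rfl fun m _ => ?_ <;> split_ifs <;> rfl
end

section
/- Fix k ≥ 1 and non-crossing partitions ρ_1, ρ_2 ∈ NC(k). For each N ≥ 1, let I be the N×N identity matrix, P = diag(1,…,1,0) and Q = diag(0,…,0,1). Let (K(ρ_1), K(ρ_2)) denote the permutation in S_{2k} whose cycles are the blocks of the Kreweras complement K(ρ_1) acting on {1,…,k} and of K(ρ_2) acting on {k+1,…,2k} (each block traversed in increasing order). Then Σ_{i=1}^{k} Σ_{j=1}^{k} Tr_{(K(ρ_1),K(ρ_2))}[I^{k−i}, Q, P^{i−1}, I^{k−j}, Q, P^{j−1}] = N^{|K(ρ_1)| + |K(ρ_2)| − 2} · |K(ρ_1)| · |K(ρ_2)| + O(N^{|K(ρ_1)| + |K(ρ_2)| − 3}) as N → ∞, where |K(ρ)| denotes the number of blocks of K(ρ). -/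
open Finset
open scoped Classical

/-- `ρ` is a partition of the finite set `S ⊆ ℕ`: its blocks are nonempty subsets of `S`
and every element of `S` lies in exactly one block. -/
def IsPartitionOn (S : Finset ℕ) (ρ : Finset (Finset ℕ)) : Prop :=
  (∀ B ∈ ρ, B.Nonempty) ∧ (∀ B ∈ ρ, B ⊆ S) ∧ (∀ x ∈ S, ∃! B, B ∈ ρ ∧ x ∈ B)

/-- A family of blocks is non-crossing if no two distinct blocks cross. -/
def IsNoncrossing (ρ : Finset (Finset ℕ)) : Prop :=
  ∀ B ∈ ρ, ∀ C ∈ ρ, B ≠ C →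
    ¬ ∃ a b c d : ℕ, a ∈ B ∧ b ∈ B ∧ c ∈ C ∧ d ∈ C ∧ a < c ∧ c < b ∧ b < d

/-- `ρ` is a non-crossing partition of `S`. -/
def IsNCPartitionOn (S : Finset ℕ) (ρ : Finset (Finset ℕ)) : Prop :=
  IsPartitionOn S ρ ∧ IsNoncrossing ρ

/-- The unbarred copy of a block: `a ↦ 2a`.  In the interleaved linear order
`s₁ < s̄₁ < s₂ < s̄₂ < ⋯` on a set of points and their barred copies, the point `a`
is encoded as `2a` and its barred copy `ā` as `2a+1`. -/
def unbarred (B : Finset ℕ) : Finset ℕ := B.image (fun a => 2 * a)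

/-- The barred copy of a block: `a ↦ 2a + 1`. -/
def barred (B : Finset ℕ) : Finset ℕ := B.image (fun a => 2 * a + 1)

/-- `ν` is the Kreweras complement of the non-crossing partition `ρ` of `S`:
`ν` is a partition of the barred copy of `S` (identified with `S`) such that
`ρ ∪ ν` is non-crossing in the interleaved order, and `ν` is maximal (coarsest)
with this property, i.e. every other such partition refines it. -/
def IsKrewerasOn (S : Finset ℕ) (ρ ν : Finset (Finset ℕ)) : Prop :=
  IsNCPartitionOn S ρ ∧ IsPartitionOn S ν ∧
  IsNoncrossing (ρ.image unbarred ∪ ν.image barred) ∧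
  ∀ ν', IsPartitionOn S ν' → IsNoncrossing (ρ.image unbarred ∪ ν'.image barred) →
    ∀ B ∈ ν', ∃ C ∈ ν, B ⊆ C

/-- If `j` is constant along the orbits of `σ` exactly when it factors through the surjection `β`,
then `Tr_σ` of diagonal matrices is a sum over functions on the target of `β`. -/
theorem trPerm_diagonal {ι κ : Type*} [Fintype ι] [DecidableEq ι] [Fintype κ] [DecidableEq κ] {N : ℕ}
    (σ : Equiv.Perm ι) (d : ι → Fin N → ℂ) (β : ι → κ) (hβ : Function.Surjective β)
    (hβσ : ∀ a, β (σ a) = β a)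
    (hconst : ∀ j : ι → Fin N, (∀ a, j (σ a) = j a) → ∀ a b, β a = β b → j a = j b) :
    trPerm σ (fun a => Matrix.diagonal (d a)) = ∑ f : κ → Fin N, ∏ a, d a (f (β a)) := by
  unfold trPerm
  have h1 : ∀ j : ι → Fin N, (∏ i, Matrix.diagonal (d i) (j i) (j (σ i)))
      = if ∀ a, j (σ a) = j a then ∏ a, d a (j a) else 0 := by
    intro j
    split_ifs with h
    · exact Finset.prod_congr rfl fun a _ => by rw [h a, Matrix.diagonal_apply_eq]
    · push Not at h
      obtain ⟨a, ha⟩ := h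
      exact Finset.prod_eq_zero (Finset.mem_univ a) (Matrix.diagonal_apply_ne _ (Ne.symm ha))
  rw [Finset.sum_congr rfl fun j _ => h1 j, ← Finset.sum_filter]
  symm
  refine Finset.sum_bij (fun f _ => f ∘ β) ?_ ?_ ?_ ?_
  · intro f _
    simp [hβσ]
  · intro f _ g _ h
    exact hβ.injective_comp_right h
  · intro j hj
    have hj' : ∀ a, j (σ a) = j a := by simpa using hj
    refine ⟨fun c => j (Function.surjInv hβ c), Finset.mem_univ _, ?_⟩
    funext a
    exact hconst j hj' _ _ (Function.surjInv_eq hβ (β a))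
  · intro f _
    rfl

theorem sum_prod_telescope (p : ℕ → ℂ) (k : ℕ) :
    ∑ m ∈ Finset.range k, ∏ a ∈ Finset.range k,
      (if a < m then 1 else if a = m then 1 - p a else p a) =
    1 - ∏ a ∈ Finset.range k, p a := by
  induction k with
  | zero => simp
  | succ k ih =>
    rw [Finset.sum_range_succ, Finset.prod_range_succ (n := k) (f := p)]
    have h1 : ∀ m ∈ Finset.range k, (∏ a ∈ Finset.range (k + 1),
        (if a < m then 1 else if a = m then 1 - p a else p a)) =
        (∏ a ∈ Finset.range k, (if a < m then 1 else if a = m then 1 - p a else p a)) * p k := by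
      intro m hm
      have := Finset.mem_range.1 hm
      rw [Finset.prod_range_succ, if_neg (by omega : ¬ k < m), if_neg (by omega : ¬ k = m)]
    have h2 : (∏ a ∈ Finset.range (k + 1),
        (if a < k then 1 else if a = k then 1 - p a else p a)) = 1 - p k := by
      rw [Finset.prod_range_succ, Finset.prod_eq_one]
      · simp
      · intro a ha
        rw [if_pos (Finset.mem_range.1 ha)]
    rw [Finset.sum_congr rfl h1, h2, ← Finset.sum_mul, ih]
    ring

theorem sum_prod_telescope_fin {k : ℕ} (p : Fin k → ℂ) :
    ∑ i ∈ Finset.Icc 1 k, ∏ a : Fin k,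
      (if (a : ℕ) < k - i then 1 else if (a : ℕ) = k - i then 1 - p a else p a) =
    1 - ∏ a, p a := by
  have h := sum_prod_telescope (fun n => if h : n < k then p ⟨n, h⟩ else 0) k
  simp only [Finset.prod_range, Fin.is_lt, dif_pos, Fin.eta] at h
  rw [← h]
  refine Finset.sum_nbij' (fun i => k - i) (fun m => k - m) ?_ ?_ ?_ ?_ ?_
  all_goals
    intro i hi
    simp only [Finset.mem_Icc, Finset.mem_range] at *
    try omega

/-- The diagonal entries of `P`. -/
noncomputable def projEntry (N : ℕ) (x : Fin N) : ℂ := if (x : ℕ) + 1 = N then 0 else 1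

theorem Pmat_eq (N : ℕ) : Pmat N = Matrix.diagonal (projEntry N) := rfl

theorem Qmat_eq (N : ℕ) : Qmat N = Matrix.diagonal (fun x => 1 - projEntry N x) := by
  unfold Qmat projEntry
  congr 1
  funext x
  split_ifs <;> simp

/-- The diagonal entries of the `a`-th matrix in the list `[I^{k−i}, Q, P^{i−1}]`. -/
noncomputable def entryIQP (N k i a : ℕ) (x : Fin N) : ℂ :=
  if a < k - i then 1 else if a = k - i then 1 - projEntry N x else projEntry N x

theorem listIQP_eq (N k i j : ℕ) :
    listIQP N k i j = fun a : Fin (k + k) => Matrix.diagonal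
      (if (a : ℕ) < k then entryIQP N k i a else entryIQP N k j ((a : ℕ) - k)) := by
  funext a
  unfold listIQP entryIQP
  rw [Pmat_eq, Qmat_eq, ← Matrix.diagonal_one]
  split_ifs <;> rfl

theorem sum_projEntry (N : ℕ) (hN : 1 ≤ N) : ∑ x : Fin N, projEntry N x = (N : ℂ) - 1 := by
  obtain ⟨n, rfl⟩ : ∃ n, N = n + 1 := ⟨N - 1, by omega⟩
  rw [Fin.sum_univ_castSucc]
  have : ∀ x : Fin n, projEntry (n + 1) x.castSucc = 1 := by
    intro x
    have := x.is_lt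
    unfold projEntry
    rw [if_neg]
    simp only [Fin.val_castSucc]
    omega
  rw [Finset.sum_congr rfl fun x _ => this x]
  simp [projEntry]

theorem projEntry_mul_self (N : ℕ) (x : Fin N) : projEntry N x * projEntry N x = projEntry N x := by
  unfold projEntry
  split_ifs <;> simp

theorem prod_projEntry_comp {ι κ : Type*} [Fintype ι] [Fintype κ] {N : ℕ} (β : ι → κ)
    (hβ : Function.Surjective β) (f : κ → Fin N) :
    ∏ a, projEntry N (f (β a)) = ∏ c, projEntry N (f c) := by
  by_cases h : ∃ c, projEntry N (f c) = 0
  · obtain ⟨c, hc⟩ := h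
    obtain ⟨a, rfl⟩ := hβ c
    rw [Finset.prod_eq_zero (Finset.mem_univ a) hc, Finset.prod_eq_zero (Finset.mem_univ (β a)) hc]
  · push Not at h
    have h1 : ∀ c, projEntry N (f c) = 1 := fun c =>
      mul_right_cancel₀ (h c) (by rw [projEntry_mul_self, one_mul])
    simp [h1]

theorem sum_one_sub_prod_projEntry {κ : Type*} [Fintype κ] [DecidableEq κ] (N : ℕ) (hN : 1 ≤ N) :
    ∑ f : κ → Fin N, (1 - ∏ c, projEntry N (f c)) =
      (N : ℂ) ^ Fintype.card κ - ((N : ℂ) - 1) ^ Fintype.card κ := by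
  rw [Finset.sum_sub_distrib, ← Fintype.prod_sum (fun (_ : κ) x => projEntry N x)]
  simp [sum_projEntry N hN]

theorem sum_trPerm_listIQP {κ₁ κ₂ : Type*} [Fintype κ₁] [Fintype κ₂] [DecidableEq κ₁]
    [DecidableEq κ₂] {k N : ℕ} (hN : 1 ≤ N)
    (σ : Equiv.Perm (Fin (k + k))) (β₁ : Fin k → κ₁) (β₂ : Fin k → κ₂)
    (h₁ : Function.Surjective β₁) (h₂ : Function.Surjective β₂)
    (β : Fin (k + k) → κ₁ ⊕ κ₂) (hβ₁ : ∀ a, β (Fin.castAdd k a) = Sum.inl (β₁ a))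
    (hβ₂ : ∀ a, β (Fin.natAdd k a) = Sum.inr (β₂ a))
    (hβσ : ∀ a, β (σ a) = β a)
    (hconst : ∀ j : Fin (k + k) → Fin N, (∀ a, j (σ a) = j a) → ∀ a b, β a = β b → j a = j b) :
    ∑ i ∈ Finset.Icc 1 k, ∑ j ∈ Finset.Icc 1 k, trPerm σ (listIQP N k i j) =
      ((N : ℂ) ^ Fintype.card κ₁ - ((N : ℂ) - 1) ^ Fintype.card κ₁) *
      ((N : ℂ) ^ Fintype.card κ₂ - ((N : ℂ) - 1) ^ Fintype.card κ₂) := by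
  have hβ : Function.Surjective β := by
    rintro (c | c)
    · obtain ⟨a, rfl⟩ := h₁ c
      exact ⟨_, hβ₁ a⟩
    · obtain ⟨a, rfl⟩ := h₂ c
      exact ⟨_, hβ₂ a⟩
  have key : ∀ i j, trPerm σ (listIQP N k i j) = ∑ f : κ₁ ⊕ κ₂ → Fin N,
      (∏ a : Fin k, entryIQP N k i a (f (Sum.inl (β₁ a)))) *
      (∏ a : Fin k, entryIQP N k j a (f (Sum.inr (β₂ a)))) := by
    intro i j
    rw [listIQP_eq, trPerm_diagonal σ _ β hβ hβσ hconst]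
    refine Finset.sum_congr rfl fun f _ => ?_
    rw [Fin.prod_univ_add]
    simp only [hβ₁, hβ₂, Fin.val_castAdd, Fin.is_lt, if_true, Fin.val_natAdd,
      Nat.not_lt.2 (Nat.le_add_right _ _), if_false, Nat.add_sub_cancel_left]
  simp only [key]
  have swap : ∑ i ∈ Finset.Icc 1 k, ∑ j ∈ Finset.Icc 1 k, ∑ f : κ₁ ⊕ κ₂ → Fin N,
      (∏ a : Fin k, entryIQP N k i a (f (Sum.inl (β₁ a)))) *
      (∏ a : Fin k, entryIQP N k j a (f (Sum.inr (β₂ a)))) =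
      ∑ f : κ₁ ⊕ κ₂ → Fin N,
      (1 - ∏ c, projEntry N (f (Sum.inl c))) * (1 - ∏ c, projEntry N (f (Sum.inr c))) := by
    simp_rw [Finset.sum_comm (s := Finset.Icc 1 k) (t := Finset.univ)]
    refine Finset.sum_congr rfl fun f _ => ?_
    rw [← Finset.sum_mul_sum]
    unfold entryIQP
    rw [sum_prod_telescope_fin, sum_prod_telescope_fin,
      prod_projEntry_comp β₁ h₁ (fun c => f (Sum.inl c)),
      prod_projEntry_comp β₂ h₂ (fun c => f (Sum.inr c))]
  rw [swap, ← sum_one_sub_prod_projEntry N hN, ← sum_one_sub_prod_projEntry N hN,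
    Finset.sum_mul_sum, ← Finset.sum_product', Finset.univ_product_univ]
  exact Fintype.sum_equiv (Equiv.sumArrowEquivProdArrow κ₁ κ₂ (Fin N)) _ _ fun f => rfl

theorem exists_bound_pow_sub_pow (n : ℕ) : ∃ C : ℝ, 0 ≤ C ∧ ∀ x : ℝ, 1 ≤ x →
    |x * (x ^ n - (x - 1) ^ n)| ≤ C * x ^ n ∧
    |x ^ 2 * (x ^ n - (x - 1) ^ n) - n * x ^ (n + 1)| ≤ C * x ^ n := by
  induction n with
  | zero => exact ⟨0, le_rfl, fun x _ => by simp⟩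
  | succ n ih =>
    obtain ⟨C, hC, h⟩ := ih
    refine ⟨2 * C + 1, by positivity, fun x hx => ?_⟩
    obtain ⟨h1, h2⟩ := h x hx
    have hx0 : 0 < x := by linarith
    have hp : 0 < x ^ n := by positivity
    have hle : x ^ n ≤ x ^ (n + 1) := pow_le_pow_right₀ hx (Nat.le_succ n)
    have hC' : C * x ^ n ≤ C * x ^ (n + 1) := mul_le_mul_of_nonneg_left hle hC
    have e1 : x * (x ^ (n + 1) - (x - 1) ^ (n + 1)) =
        x * (x * (x ^ n - (x - 1) ^ n)) + x ^ (n + 1) - x * (x ^ n - (x - 1) ^ n) := by ring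
    have e2 : x ^ 2 * (x ^ (n + 1) - (x - 1) ^ (n + 1)) - ((n + 1 : ℕ) : ℝ) * x ^ (n + 1 + 1) =
        x * (x ^ 2 * (x ^ n - (x - 1) ^ n) - n * x ^ (n + 1))
          - x * (x * (x ^ n - (x - 1) ^ n)) := by
      push_cast
      ring
    have e3 : C * x ^ (n + 1) = x * (C * x ^ n) := by ring
    have m1 : |x * (x * (x ^ n - (x - 1) ^ n))| ≤ C * x ^ (n + 1) := by
      rw [abs_mul, abs_of_pos hx0, e3]
      exact mul_le_mul_of_nonneg_left h1 hx0.le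
    have m2 : |x * (x ^ 2 * (x ^ n - (x - 1) ^ n) - n * x ^ (n + 1))| ≤ C * x ^ (n + 1) := by
      rw [abs_mul, abs_of_pos hx0, e3]
      exact mul_le_mul_of_nonneg_left h2 hx0.le
    have hq : 0 < x ^ (n + 1) := by positivity
    rw [e1, e2]
    rw [abs_le] at h1 m1 m2 ⊢
    rw [abs_le]
    refine ⟨⟨?_, ?_⟩, ?_, ?_⟩ <;> linarith [h1.1, h1.2, m1.1, m1.2, m2.1, m2.2]

theorem exists_bound_mul_pow_sub_pow (a b : ℕ) (ha : 1 ≤ a) (hb : 1 ≤ b) :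
    ∃ C : ℝ, ∀ x : ℝ, 1 ≤ x →
      |(x ^ a - (x - 1) ^ a) * (x ^ b - (x - 1) ^ b) - x ^ (a + b - 2) * (a * b)|
        ≤ C * x ^ (a + b) / x ^ 3 := by
  obtain ⟨C, hC, h⟩ := exists_bound_pow_sub_pow a
  obtain ⟨D, hD, h'⟩ := exists_bound_pow_sub_pow b
  refine ⟨C * D + a * D, fun x hx => ?_⟩
  obtain ⟨-, h2⟩ := h x hx
  obtain ⟨k1, k2⟩ := h' x hx
  have hx0 : 0 < x := by linarith
  rw [le_div_iff₀ (by positivity)]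
  refine le_of_mul_le_mul_right ?_ hx0
  have hpow : x ^ (a + b) = x ^ (a + b - 2) * x ^ 2 := by
    rw [← pow_add]
    congr 1
    omega
  set S := x ^ a - (x - 1) ^ a
  set T := x ^ b - (x - 1) ^ b
  calc |S * T - x ^ (a + b - 2) * (a * b)| * x ^ 3 * x
      = |(S * T - x ^ (a + b - 2) * (a * b)) * x ^ 4| := by
        rw [abs_mul, abs_of_pos (by positivity : 0 < x ^ 4)]
        ring
    _ = |(x ^ 2 * S - a * x ^ (a + 1)) * (x * (x * T))
          + a * x ^ (a + 1) * (x ^ 2 * T - b * x ^ (b + 1))| := by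
        congr 1
        have : x ^ (a + b - 2) * x ^ 4 = x ^ (a + 1) * x ^ (b + 1) := by
          rw [show x ^ (a + b - 2) * x ^ 4 = x ^ (a + b - 2) * x ^ 2 * x ^ 2 by ring, ← hpow]
          ring
        linear_combination (-(a * b : ℝ)) * this
    _ ≤ |(x ^ 2 * S - a * x ^ (a + 1)) * (x * (x * T))|
          + |a * x ^ (a + 1) * (x ^ 2 * T - b * x ^ (b + 1))| := abs_add_le _ _
    _ ≤ (C * x ^ a) * (x * (D * x ^ b)) + a * x ^ (a + 1) * (D * x ^ b) := by
        rw [abs_mul, abs_mul x, abs_of_pos hx0, abs_mul (a * x ^ (a + 1)),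
          abs_of_nonneg (by positivity : 0 ≤ (a : ℝ) * x ^ (a + 1))]
        gcongr
    _ = (C * D + a * D) * x ^ (a + b) * x := by ring

/-- The map sending each point to its block. -/
theorem IsPartitionOn.exists_block {k : ℕ} {ν : Finset (Finset ℕ)}
    (hν : IsPartitionOn (Finset.Icc 1 k) ν) :
    ∃ β : Fin k → ν, Function.Surjective β ∧
      ∀ (a : Fin k) (B : ν), (a : ℕ) + 1 ∈ (B : Finset ℕ) ↔ β a = B := by
  obtain ⟨hne, hsub, huniq⟩ := hν
  have hex : ∀ a : Fin k, ∃! B, B ∈ ν ∧ (a : ℕ) + 1 ∈ B := fun a =>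
    huniq _ (Finset.mem_Icc.2 ⟨by omega, by omega⟩)
  choose β hβ hβu using hex
  have hmem : ∀ (a : Fin k) (B : ν),
      (a : ℕ) + 1 ∈ (B : Finset ℕ) ↔ (⟨β a, (hβ a).1⟩ : ν) = B := by
    intro a B
    constructor
    · intro h
      exact Subtype.ext (hβu a B ⟨B.2, h⟩).symm
    · rintro rfl
      exact (hβ a).2
  refine ⟨fun a => ⟨β a, (hβ a).1⟩, fun B => ?_, hmem⟩
  obtain ⟨t, ht⟩ := hne B B.2
  have htk := Finset.mem_Icc.1 (hsub B B.2 ht)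
  refine ⟨⟨t - 1, by omega⟩, (hmem _ B).1 ?_⟩
  rwa [show t - 1 + 1 = t by omega]

/-- A function invariant under a permutation that steps through the block `B` in increasing order
is constant on `B`. -/
theorem eq_of_increasing_steps {n : ℕ} {X : Type*} (σ : Equiv.Perm (Fin n)) (B : Finset ℕ)
    (hB : ∀ a : Fin n, (a : ℕ) + 1 ∈ B → (σ a : ℕ) + 1 ∈ B ∧
      ((a : ℕ) < (σ a : ℕ) ∨ ∀ b ∈ B, b ≤ (a : ℕ) + 1))
    (j : Fin n → X) (hj : ∀ a, j (σ a) = j a) (a b : Fin n)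
    (ha : (a : ℕ) + 1 ∈ B) (hb : (b : ℕ) + 1 ∈ B) : j a = j b := by
  have reach : ∀ (m : ℕ) (c : Fin n), n - (c : ℕ) = m → (c : ℕ) + 1 ∈ B →
      ∃ d : Fin n, (d : ℕ) + 1 ∈ B ∧ (∀ b ∈ B, b ≤ (d : ℕ) + 1) ∧ j c = j d := by
    intro m
    induction m using Nat.strong_induction_on with
    | _ m ih =>
      intro c hcm hc
      obtain ⟨h1, h2 | h2⟩ := hB c hc
      · obtain ⟨d, hd, hdm, e⟩ := ih (n - (σ c : ℕ)) (by omega) (σ c) rfl h1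
        exact ⟨d, hd, hdm, by rw [← e, hj]⟩
      · exact ⟨c, hc, h2, rfl⟩
  obtain ⟨d, hd, hdm, e⟩ := reach _ a rfl ha
  obtain ⟨d', hd', hdm', e'⟩ := reach _ b rfl hb
  have : d = d' := Fin.ext (by
    have := hdm _ hd'
    have := hdm' _ hd
    omega)
  rw [e, e', this]

/-- Fix `k ≥ 1` and non-crossing partitions `ρ₁, ρ₂ ∈ NC(k)` with
Kreweras complements `ν₁ = K(ρ₁)`, `ν₂ = K(ρ₂)`.  Let `σ ∈ S_{2k}` be the permutation
whose cycles are the blocks of `K(ρ₁)` acting on `{1,…,k}` and of `K(ρ₂)` acting on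
`{k+1,…,2k}`, each block traversed in increasing order (so `σ` maps each point to the
next larger point of its block, and the largest point of a block to the smallest one).
Then, with `I`, `P = diag(1,…,1,0)`, `Q = diag(0,…,0,1)` of size `N`,
`Σ_{i=1}^k Σ_{j=1}^k Tr_σ[I^{k−i}, Q, P^{i−1}, I^{k−j}, Q, P^{j−1}]
 = N^{|K(ρ₁)|+|K(ρ₂)|−2}·|K(ρ₁)|·|K(ρ₂)| + O(N^{|K(ρ₁)|+|K(ρ₂)|−3})` as `N → ∞`. -/
theorem statement15 (k : ℕ) (hk : 1 ≤ k)
    (ρ₁ ρ₂ : Finset (Finset ℕ))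
    (hρ₁ : IsNCPartitionOn (Finset.Icc 1 k) ρ₁)
    (hρ₂ : IsNCPartitionOn (Finset.Icc 1 k) ρ₂)
    -- the Kreweras complements `ν₁ = K(ρ₁)` and `ν₂ = K(ρ₂)`:
    (ν₁ ν₂ : Finset (Finset ℕ))
    (hν₁ : IsKrewerasOn (Finset.Icc 1 k) ρ₁ ν₁)
    (hν₂ : IsKrewerasOn (Finset.Icc 1 k) ρ₂ ν₂)
    -- `σ ∈ S_{2k}`: the permutation whose cycles are the blocks of `K(ρ₁)` on
    -- `{1,…,k}` and of `K(ρ₂)` on `{k+1,…,2k}`, traversed in increasing order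
    -- (the point `t ∈ {1,…,2k}` is encoded as `a : Fin (k+k)` with `a + 1 = t`):
    (σ : Equiv.Perm (Fin (k + k)))
    (hσ : ∀ B ∈ ν₁ ∪ ν₂.image (fun B => B.image (fun t => t + k)),
      ∀ a : Fin (k + k), (a : ℕ) + 1 ∈ B →
        ((σ a : ℕ) + 1 ∈ B ∧
          (((a : ℕ) + 1 < (σ a : ℕ) + 1 ∧
              ∀ b ∈ B, (a : ℕ) + 1 < b → (σ a : ℕ) + 1 ≤ b) ∨
            ((∀ b ∈ B, b ≤ (a : ℕ) + 1) ∧ ∀ b ∈ B, (σ a : ℕ) + 1 ≤ b)))) :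
    ∃ C : ℝ, ∀ N : ℕ, 1 ≤ N →
      ‖(∑ i ∈ Finset.Icc 1 k, ∑ j ∈ Finset.Icc 1 k, trPerm σ (listIQP N k i j))
          - (N : ℂ) ^ (ν₁.card + ν₂.card - 2) * ((ν₁.card : ℂ) * (ν₂.card : ℂ))‖
        ≤ C * (N : ℝ) ^ (ν₁.card + ν₂.card) / (N : ℝ) ^ 3 := by
  obtain ⟨β₁, h₁, m₁⟩ := hν₁.2.1.exists_block
  obtain ⟨β₂, h₂, m₂⟩ := hν₂.2.1.exists_block
  have c₁ : 1 ≤ ν₁.card := Finset.card_pos.2 ⟨_, (β₁ ⟨0, hk⟩).2⟩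
  have c₂ : 1 ≤ ν₂.card := Finset.card_pos.2 ⟨_, (β₂ ⟨0, hk⟩).2⟩
  let β : Fin (k + k) → ν₁ ⊕ ν₂ :=
    Fin.addCases (motive := fun _ => ν₁ ⊕ ν₂) (fun a => Sum.inl (β₁ a)) (fun a => Sum.inr (β₂ a))
  have hβ₁ : ∀ a, β (Fin.castAdd k a) = Sum.inl (β₁ a) := fun a => Fin.addCases_left a
  have hβ₂ : ∀ a, β (Fin.natAdd k a) = Sum.inr (β₂ a) := fun a => Fin.addCases_right a
  -- the block of `{1,…,2k}` corresponding to a label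
  let blk : ν₁ ⊕ ν₂ → Finset ℕ :=
    Sum.elim (fun B => (B : Finset ℕ)) (fun B => (B : Finset ℕ).image (fun t => t + k))
  have hblk : ∀ c, blk c ∈ ν₁ ∪ ν₂.image (fun B => B.image (fun t => t + k)) := by
    rintro (B | B)
    · exact Finset.mem_union_left _ B.2
    · exact Finset.mem_union_right _ (Finset.mem_image_of_mem _ B.2)
  have hmem : ∀ (a : Fin (k + k)) c, (a : ℕ) + 1 ∈ blk c ↔ β a = c := by
    intro a c
    induction a using Fin.addCases with
    | left a =>
      rw [hβ₁]
      rcases c with B | B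
      · simp [blk, m₁]
      · simp only [blk, Sum.elim_inr, Finset.mem_image, Fin.val_castAdd, reduceCtorEq, iff_false]
        rintro ⟨t, ht, e⟩
        have := Finset.mem_Icc.1 (hν₂.2.1.2.1 B B.2 ht)
        omega
    | right a =>
      rw [hβ₂]
      rcases c with B | B
      · simp only [blk, Sum.elim_inl, Fin.val_natAdd, reduceCtorEq, iff_false]
        intro ht
        have := Finset.mem_Icc.1 (hν₁.2.1.2.1 B B.2 ht)
        omega
      · rw [Sum.inr.injEq, ← m₂]
        simp only [blk, Sum.elim_inr, Finset.mem_image, Fin.val_natAdd]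
        constructor
        · rintro ⟨t, ht, e⟩
          rwa [show (a : ℕ) + 1 = t by omega]
        · intro h
          exact ⟨_, h, by omega⟩
  have hβσ : ∀ a, β (σ a) = β a := fun a =>
    (hmem _ _).1 (hσ _ (hblk (β a)) a ((hmem a _).2 rfl)).1
  have hstep : ∀ c, ∀ a : Fin (k + k), (a : ℕ) + 1 ∈ blk c → (σ a : ℕ) + 1 ∈ blk c ∧
      ((a : ℕ) < (σ a : ℕ) ∨ ∀ b ∈ blk c, b ≤ (a : ℕ) + 1) := by
    intro c a ha
    obtain ⟨h, h' | h'⟩ := hσ _ (hblk c) a ha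
    · exact ⟨h, Or.inl (by omega)⟩
    · exact ⟨h, Or.inr h'.1⟩
  obtain ⟨C, hC⟩ := exists_bound_mul_pow_sub_pow ν₁.card ν₂.card c₁ c₂
  refine ⟨C, fun N hN => ?_⟩
  rw [sum_trPerm_listIQP hN σ β₁ β₂ h₁ h₂ β hβ₁ hβ₂ hβσ
    (fun j hj a b hab => eq_of_increasing_steps σ (blk (β b)) (hstep _) j hj a b
      ((hmem a _).2 hab) ((hmem b _).2 rfl)), Fintype.card_coe, Fintype.card_coe]
  have := hC N (by exact_mod_cast hN)
  rw [← Real.norm_eq_abs, ← Complex.norm_real] at this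
  convert this using 2
  push_cast
  ring
end
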